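/- (Monotone part of the Bercovici–Pata limit theorem.) Let σ be a finite positive Borel measure on ℝ, γ ∈ ℝ, (μ_n) a sequence of Borel probability measures on ℝ, and k₁ < k₂ < ⋯ a strictly increasing sequence of positive integers. Let (ρ_n) be Borel probability measures on ℝ whose F-transforms satisfy F_{ρ_n} = F_{μ_n} ∘ F_{μ_n} ∘ ⋯ ∘ F_{μ_n} (k_n-fold composition) on ℂ⁺ (these are the monotone convolution powers μ_n^{▷k_n}). Let Φ : ℂ⁺ → ℂ be given by Φ(z) = γ + ∫_ℝ (1 + xz)/(z − x) dσ(x), let (F_t)_{t≥0} be a family of analytic maps F_t : ℂ⁺ → ℂ⁺ with F_0(z) = z and (∂/∂t) F_t(z) = −Φ(F_t(z)) for all z ∈ ℂ⁺, and let ν be a Borel probability measure on ℝ with F_ν = F_1. Then the following are equivalent: (1) ρ_n converges weakly to ν; (2) the finite measures with density k_n x²/(1 + x²) with respect to μ_n converge weakly to σ, and k_n ∫_ℝ x/(1 + x²) dμ_n(x) → γ. -/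

import Mathlib

open MeasureTheory Filter Topology Set

/-- The Cauchy transform `G_μ(z) = ∫ 1/(z - x) dμ(x)` of a measure on `ℝ`. -/
noncomputable def cauchyTransform (μ : Measure ℝ) (z : ℂ) : ℂ :=
  ∫ x, (z - (x : ℂ))⁻¹ ∂μ

/-- The `F`-transform `F_μ = 1/G_μ`. -/
noncomputable def Ftransform (μ : Measure ℝ) (z : ℂ) : ℂ :=
  (cauchyTransform μ z)⁻¹

/-- Weak convergence of a sequence of finite Borel measures on `ℝ`. -/
def WeakLim (ρ : ℕ → Measure ℝ) (ρlim : Measure ℝ) : Prop :=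
  ∀ g : BoundedContinuousFunction ℝ ℝ,
    Tendsto (fun n => ∫ x, g x ∂(ρ n)) atTop (𝓝 (∫ x, g x ∂ρlim))

/-- Hyperbolic distance on the upper half-plane, as a function on `ℂ`. -/
noncomputable def hypd (z w : ℂ) : ℝ :=
  2 * Real.arsinh (dist z w / (2 * √(z.im * w.im)))

lemma hypd_eq {z w : ℂ} (hz : 0 < z.im) (hw : 0 < w.im) :
    hypd z w = dist (⟨z, hz⟩ : UpperHalfPlane) ⟨w, hw⟩ := rfl

lemma hypd_nonneg {z w : ℂ} (hz : 0 < z.im) (hw : 0 < w.im) : 0 ≤ hypd z w := by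
  rw [hypd_eq hz hw]; exact dist_nonneg

lemma hypd_self {z : ℂ} : hypd z z = 0 := by simp [hypd]

lemma hypd_comm {z w : ℂ} : hypd z w = hypd w z := by
  simp [hypd, dist_comm z w, mul_comm z.im]

lemma hypd_triangle {a b c : ℂ} (ha : 0 < a.im) (hb : 0 < b.im) (hc : 0 < c.im) :
    hypd a c ≤ hypd a b + hypd b c := by
  rw [hypd_eq ha hb, hypd_eq hb hc, hypd_eq ha hc]; exact dist_triangle _ _ _

lemma im_le_hypd {z w : ℂ} (hz : 0 < z.im) (hw : 0 < w.im) :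
    z.im ≤ w.im * Real.exp (hypd z w) := by
  rw [hypd_eq hz hw]; exact UpperHalfPlane.im_le_im_mul_exp_dist ⟨z, hz⟩ ⟨w, hw⟩

lemma norm_sub_le_hypd {z w : ℂ} (hz : 0 < z.im) (hw : 0 < w.im) :
    ‖z - w‖ ≤ w.im * (Real.exp (hypd z w) - 1) := by
  rw [hypd_eq hz hw, ← dist_eq_norm]; exact UpperHalfPlane.dist_coe_le ⟨z, hz⟩ ⟨w, hw⟩

lemma hypd_le_norm {z w : ℂ} {m : ℝ} (hm : 0 < m) (hz : m ≤ z.im) (hw : m ≤ w.im) :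
    hypd z w ≤ ‖z - w‖ / m := by
  have hz' : 0 < z.im := hm.trans_le hz
  have hw' : 0 < w.im := hm.trans_le hw
  rw [hypd_eq hz' hw']
  refine (UpperHalfPlane.dist_le_dist_coe_div_sqrt ⟨z, hz'⟩ ⟨w, hw'⟩).trans ?_
  change dist z w / √(z.im * w.im) ≤ _
  rw [dist_eq_norm]
  gcongr
  apply Real.le_sqrt_of_sq_le
  nlinarith

/-- The open upper half plane. -/
def UHP : Set ℂ := {z : ℂ | 0 < z.im}

lemma isOpen_UHP : IsOpen UHP := isOpen_lt continuous_const Complex.continuous_im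

lemma convex_UHP : Convex ℝ UHP := convex_halfSpace_im_gt 0

lemma tanh_half_hypd {z w : ℂ} (hz : 0 < z.im) (hw : 0 < w.im) :
    Real.tanh (hypd z w / 2) = ‖z - w‖ / ‖z - (starRingEnd ℂ) w‖ := by
  rw [hypd_eq hz hw, UpperHalfPlane.tanh_half_dist, dist_eq_norm, dist_eq_norm]

lemma cayley_norm_lt {z w : ℂ} (hz : 0 < z.im) (hw : 0 < w.im) :
    ‖(z - w) / (z - (starRingEnd ℂ) w)‖ < 1 := by
  rw [norm_div, ← tanh_half_hypd hz hw]
  exact Real.tanh_lt_one _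

lemma sub_conj_ne {z w : ℂ} (hz : 0 < z.im) (hw : 0 < w.im) :
    z - (starRingEnd ℂ) w ≠ 0 := by
  intro h
  have := congrArg Complex.im h
  simp at this
  linarith

/-- Schwarz-Pick on the upper half plane. -/
lemma schwarz_pick {f : ℂ → ℂ} (hf : DifferentiableOn ℂ f UHP)
    (hm : ∀ z ∈ UHP, 0 < (f z).im) {z w : ℂ} (hz : 0 < z.im) (hw : 0 < w.im) :
    hypd (f z) (f w) ≤ hypd z w := by
  set C : ℂ → ℂ := fun ζ => (w - (starRingEnd ℂ) w * ζ) / (1 - ζ) with hC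
  have h1 : ∀ ζ ∈ Metric.ball (0:ℂ) 1, 1 - ζ ≠ 0 := by
    intro ζ hζ h
    have : ζ = 1 := by linear_combination -h
    simp [this] at hζ
  have hCmaps : ∀ ζ ∈ Metric.ball (0:ℂ) 1, C ζ ∈ UHP := by
    intro ζ hζ
    have hne := h1 ζ hζ
    have hn : Complex.normSq ζ < 1 := by
      rw [Complex.normSq_eq_norm_sq]
      have : ‖ζ‖ < 1 := by simpa using hζ
      nlinarith [norm_nonneg ζ]
    have : (C ζ).im = w.im * (1 - Complex.normSq ζ) / Complex.normSq (1 - ζ) := by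
      simp only [hC, Complex.div_im]
      simp [Complex.normSq_apply]
      ring
    change 0 < (C ζ).im
    rw [this]
    have : 0 < Complex.normSq (1 - ζ) := Complex.normSq_pos.2 hne
    apply div_pos _ this
    apply mul_pos hw; linarith
  have hCd : DifferentiableOn ℂ C (Metric.ball 0 1) := by
    intro ζ hζ
    apply DifferentiableAt.differentiableWithinAt
    have := h1 ζ hζ
    simp only [hC]
    fun_prop (disch := assumption)
  set ζ0 := (z - w) / (z - (starRingEnd ℂ) w) with hζ0
  have hzetan : ‖ζ0‖ < 1 := cayley_norm_lt hz hw
  have hCζ0 : C ζ0 = z := by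
    have hne := sub_conj_ne hz hw
    have hne2 := sub_conj_ne hw hw
    have hne3 : 1 - ζ0 ≠ 0 := h1 _ (by simpa using hzetan)
    simp only [hC]
    rw [div_eq_iff hne3, hζ0]
    field_simp
    ring
  have hC0 : C 0 = w := by simp [hC]
  set g : ℂ → ℂ := fun ζ => (f (C ζ) - f w) / (f (C ζ) - (starRingEnd ℂ) (f w)) with hg
  have hfw : 0 < (f w).im := hm w hw
  have hgd : DifferentiableOn ℂ g (Metric.ball 0 1) := by
    have h2 : DifferentiableOn ℂ (fun ζ => f (C ζ)) (Metric.ball 0 1) := hf.comp hCd hCmaps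
    exact (h2.sub_const _).div (h2.sub_const _)
      (fun ζ hζ => sub_conj_ne (hm _ (hCmaps ζ hζ)) hfw)
  have hgm : MapsTo g (Metric.ball 0 1) (Metric.closedBall 0 1) := by
    intro ζ hζ
    simpa [hg] using (cayley_norm_lt (hm _ (hCmaps ζ hζ)) hfw).le
  have hg0 : g 0 = 0 := by simp [hg, hC0]
  have := Complex.norm_le_norm_of_mapsTo_ball hgd hgm hg0 hzetan
  have hfz : 0 < (f z).im := hm z hz
  simp only [hg, hCζ0] at this
  rw [hζ0, norm_div, norm_div] at this
  rw [← tanh_half_hypd hz hw, ← tanh_half_hypd hfz hfw] at this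
  have := Real.artanh_le_artanh (Real.neg_one_lt_tanh _) (Real.tanh_lt_one _) this
  rw [Real.artanh_tanh, Real.artanh_tanh] at this
  linarith

/-- Harnack-type estimate for maps into the closed upper half plane. -/
lemma harnack {f : ℂ → ℂ} (hf : DifferentiableOn ℂ f UHP)
    (hm : ∀ z ∈ UHP, 0 ≤ (f z).im) {z w : ℂ} (hz : 0 < z.im) (hw : 0 < w.im) :
    ‖f z - f w‖ ≤ (f w).im * (Real.exp (hypd z w) - 1) := by
  have key : ∀ η : ℝ, 0 < η → ‖f z - f w‖ ≤ ((f w).im + η) * (Real.exp (hypd z w) - 1) := by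
    intro η hη
    set g : ℂ → ℂ := fun z => f z + η * Complex.I
    have gim : ∀ z, (g z).im = (f z).im + η := by intro z; simp [g]
    have hgp : ∀ z ∈ UHP, 0 < (g z).im := by
      intro z hz; rw [gim]; linarith [hm z hz]
    have h1 := schwarz_pick (f := g) (hf.add_const _) hgp hz hw
    have h2 := norm_sub_le_hypd (hgp z hz) (hgp w hw)
    have h3 : g z - g w = f z - f w := by simp [g]
    rw [h3, gim] at h2
    refine h2.trans ?_
    have := hm w hw
    gcongr
  have : Tendsto (fun η : ℝ => ((f w).im + η) * (Real.exp (hypd z w) - 1)) (𝓝[>] 0)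
      (𝓝 (((f w).im + 0) * (Real.exp (hypd z w) - 1))) := by
    apply Tendsto.mono_left _ nhdsWithin_le_nhds
    exact ((continuous_const.add continuous_id).mul continuous_const).tendsto 0
  rw [add_zero] at this
  exact ge_of_tendsto this (by filter_upwards [self_mem_nhdsWithin] with η hη using key η hη)

lemma harnack_im {f : ℂ → ℂ} (hf : DifferentiableOn ℂ f UHP)
    (hm : ∀ z ∈ UHP, 0 ≤ (f z).im) {z w : ℂ} (hz : 0 < z.im) (hw : 0 < w.im) :
    (f z).im ≤ (f w).im * Real.exp (hypd z w) := by
  have := harnack hf hm hz hw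
  have h2 := Complex.abs_im_le_norm (f z - f w)
  have h3 := le_abs_self (f z - f w).im
  simp only [Complex.sub_im] at h3 h2
  linarith

/-- Iteration lemma. -/
lemma iterate_mem {A : ℂ → ℂ} (hA : ∀ z ∈ UHP, z.im ≤ (A z).im) {w : ℂ} (hw : w ∈ UHP) (j : ℕ) :
    w.im ≤ (A^[j] w).im := by
  induction j with
  | zero => simp
  | succ j ih =>
    rw [Function.iterate_succ_apply']
    exact ih.trans (hA _ (lt_of_lt_of_le hw ih))

lemma hypd_iterate {A : ℂ → ℂ} (hAd : DifferentiableOn ℂ A UHP)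
    (hA : ∀ z ∈ UHP, z.im ≤ (A z).im) {w : ℂ} (hw : w ∈ UHP) (j : ℕ) :
    hypd (A^[j] w) w ≤ j * (‖A w - w‖ / w.im) := by
  have hm : ∀ z ∈ UHP, 0 < (A z).im := fun z hz => lt_of_lt_of_le hz (hA z hz)
  induction j with
  | zero => simp [hypd_self]
  | succ j ih =>
    have hj : 0 < (A^[j] w).im := lt_of_lt_of_le hw (iterate_mem hA hw j)
    rw [Function.iterate_succ_apply']
    have h1 := hypd_triangle (hm _ hj) (hm w hw) hw
    have h2 := schwarz_pick hAd hm hj hw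
    have h3 := hypd_le_norm (z := A w) (w := w) hw (hA w hw) le_rfl
    push_cast
    linarith

lemma iterate_sub {A : ℂ → ℂ} (w : ℂ) (k : ℕ) :
    A^[k] w - w = ∑ j ∈ Finset.range k, (A (A^[j] w) - A^[j] w) := by
  induction k with
  | zero => simp
  | succ k ih => rw [Finset.sum_range_succ, ← ih, Function.iterate_succ_apply']; ring

lemma disc_est {A : ℂ → ℂ} (hAd : DifferentiableOn ℂ A UHP)
    (hA : ∀ z ∈ UHP, z.im ≤ (A z).im) {w : ℂ} (hw : w ∈ UHP) (k : ℕ) :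
    ‖A^[k] w - w - k * (A w - w)‖ ≤
      (Real.exp (k * ‖A w - w‖ / w.im) - 1) * (k * (A w - w).im) := by
  have hfd : DifferentiableOn ℂ (fun z => A z - z) UHP := hAd.sub differentiableOn_id
  have hfm : ∀ z ∈ UHP, 0 ≤ (A z - z).im := by
    intro z hz; simp only [Complex.sub_im]; linarith [hA z hz]
  have h0 : (k : ℂ) * (A w - w) = ∑ j ∈ Finset.range k, (A w - w) := by simp [mul_sub]
  rw [iterate_sub, h0, ← Finset.sum_sub_distrib]
  refine (norm_sum_le _ _).trans ?_
  have : ∀ j ∈ Finset.range k, ‖A (A^[j] w) - A^[j] w - (A w - w)‖ ≤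
      (Real.exp (k * ‖A w - w‖ / w.im) - 1) * (A w - w).im := by
    intro j hj
    have hj' : 0 < (A^[j] w).im := lt_of_lt_of_le hw (iterate_mem hA hw j)
    refine (harnack hfd hfm hj' hw).trans ?_
    rw [mul_comm]
    have h1 := hypd_iterate hAd hA hw j
    have h2 : hypd (A^[j] w) w ≤ k * ‖A w - w‖ / w.im := by
      refine h1.trans ?_
      rw [mul_div_assoc]
      have : (j : ℝ) ≤ k := by exact_mod_cast (Finset.mem_range.1 hj).le
      have hw' : (0:ℝ) < w.im := hw
      gcongr
    have := hfm w hw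
    gcongr
  refine (Finset.sum_le_sum this).trans ?_
  simp only [Finset.sum_const, Finset.card_range, nsmul_eq_mul]
  apply le_of_eq; ring

lemma disc_est_im {A : ℂ → ℂ} (hAd : DifferentiableOn ℂ A UHP)
    (hA : ∀ z ∈ UHP, z.im ≤ (A z).im) {w : ℂ} (hw : w ∈ UHP) (k : ℕ) :
    k * (A w - w).im ≤ Real.exp (k * ‖A w - w‖ / w.im) * (A^[k] w - w).im := by
  have hfd : DifferentiableOn ℂ (fun z => A z - z) UHP := hAd.sub differentiableOn_id
  have hfm : ∀ z ∈ UHP, 0 ≤ (A z - z).im := by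
    intro z hz; simp only [Complex.sub_im]; linarith [hA z hz]
  rw [iterate_sub, Complex.im_sum, Finset.mul_sum]
  have : ∀ j ∈ Finset.range k, (A w - w).im ≤
      Real.exp (k * ‖A w - w‖ / w.im) * (A (A^[j] w) - A^[j] w).im := by
    intro j hj
    have hj' : 0 < (A^[j] w).im := lt_of_lt_of_le hw (iterate_mem hA hw j)
    refine (harnack_im hfd hfm hw hj').trans ?_
    rw [mul_comm, hypd_comm]
    have h1 := hypd_iterate hAd hA hw j
    have h2 : hypd (A^[j] w) w ≤ k * ‖A w - w‖ / w.im := by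
      refine h1.trans ?_
      rw [mul_div_assoc]
      have : (j : ℝ) ≤ k := by exact_mod_cast (Finset.mem_range.1 hj).le
      have hw' : (0:ℝ) < w.im := hw
      gcongr
    have := hfm _ hj'
    gcongr
  calc (k : ℝ) * (A w - w).im = ∑ j ∈ Finset.range k, (A w - w).im := by simp [mul_sub]
    _ ≤ _ := Finset.sum_le_sum this

lemma continuousAt_hypd {x : ℂ} (hx : 0 < x.im) : ContinuousAt (fun y => hypd y x) x := by
  have h : 2 * √(x.im * x.im) ≠ 0 := by positivity
  unfold hypd
  apply ContinuousAt.mul continuousAt_const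
  apply Real.continuous_arsinh.continuousAt.comp
  apply ContinuousAt.div
  · fun_prop
  · apply Continuous.continuousAt
    have := Complex.continuous_im
    fun_prop
  · exact h

lemma locunif {ι : Type*} {l : Filter ι} [l.NeBot] {g : ι → ℂ → ℂ} {G : ℂ → ℂ}
    (hd : ∀ n, DifferentiableOn ℂ (g n) UHP) (hm : ∀ n, ∀ z ∈ UHP, 0 ≤ (g n z).im)
    (hl : ∀ z ∈ UHP, Tendsto (fun n => g n z) l (𝓝 (G z))) :
    TendstoLocallyUniformlyOn g G l UHP := by
  rw [Metric.tendstoLocallyUniformlyOn_iff]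
  intro ε hε x hx
  have hx' : 0 < x.im := hx
  have hG : ∀ y ∈ UHP, ‖G y - G x‖ ≤ (G x).im * (Real.exp (hypd y x) - 1) := by
    intro y hy
    have h1 : Tendsto (fun n => ‖g n y - g n x‖) l (𝓝 ‖G y - G x‖) := ((hl y hy).sub (hl x hx)).norm
    have h2 : Tendsto (fun n => (g n x).im * (Real.exp (hypd y x) - 1)) l
        (𝓝 ((G x).im * (Real.exp (hypd y x) - 1))) :=
      ((Complex.continuous_im.tendsto _).comp (hl x hx)).mul_const _
    exact le_of_tendsto_of_tendsto' h1 h2 (fun n => harnack (hd n) (hm n) hy hx)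
  have hGx : 0 ≤ (G x).im :=
    ge_of_tendsto' ((Complex.continuous_im.tendsto _).comp (hl x hx)) (fun n => hm n x hx)
  set t : Set ℂ := {y | y ∈ UHP ∧ ((G x).im + 1) * (Real.exp (hypd y x) - 1) < ε / 3} with ht
  have htn : t ∈ 𝓝[UHP] x := by
    have hc : ContinuousAt (fun y => ((G x).im + 1) * (Real.exp (hypd y x) - 1)) x := by
      have := continuousAt_hypd hx'
      fun_prop
    have h3 := hc.tendsto.eventually_lt_const (u := ε / 3) (by simp [hypd_self]; positivity)
    filter_upwards [self_mem_nhdsWithin, nhdsWithin_le_nhds h3] with y h1 h2 using ⟨h1, h2⟩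
  refine ⟨t, htn, ?_⟩
  have e1 := (Metric.tendsto_nhds.1 (hl x hx)) (min 1 (ε/3)) (by positivity)
  filter_upwards [e1] with n hn y hy
  have hn1 : ‖g n x - G x‖ < 1 := by rw [← dist_eq_norm]; exact hn.trans_le (min_le_left _ _)
  have hn2 : ‖g n x - G x‖ < ε / 3 := by rw [← dist_eq_norm]; exact hn.trans_le (min_le_right _ _)
  have him : (g n x).im ≤ (G x).im + 1 := by
    have := (le_abs_self _).trans (Complex.abs_im_le_norm (g n x - G x))
    simp only [Complex.sub_im] at this
    linarith
  have hexp : 0 ≤ Real.exp (hypd y x) - 1 := by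
    have := Real.one_le_exp (hypd_nonneg hy.1 hx'); linarith
  have b1 : ‖g n y - g n x‖ < ε / 3 := by
    refine ((harnack (hd n) (hm n) hy.1 hx).trans ?_).trans_lt hy.2
    gcongr
  have b2 : ‖G y - G x‖ < ε / 3 := by
    refine ((hG y hy.1).trans ?_).trans_lt hy.2
    gcongr; linarith
  rw [dist_eq_norm]
  have : G y - g n y = (G y - G x) - (g n x - G x) - (g n y - g n x) := by ring
  rw [this]
  have := norm_sub_le (G y - G x - (g n x - G x)) (g n y - g n x)
  have := norm_sub_le (G y - G x) (g n x - G x)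
  linarith

/-- `Ψ` behaves like an infinitesimal generator of `F`. -/
structure IsGen (F Ψ : ℂ → ℂ) : Prop where
  diff : DifferentiableOn ℂ Ψ UHP
  im_nonneg : ∀ z ∈ UHP, 0 ≤ (Ψ z).im
  comm : ∀ z ∈ UHP, Ψ (F z) = deriv F z * Ψ z
  contr : ∀ z ∈ UHP, ‖Ψ (F z)‖ ≤ (F z).im * (‖Ψ z‖ / z.im)
  est : ∀ w ∈ UHP, ‖F w - w - Ψ w‖ ≤ (Real.exp (‖Ψ w‖ / w.im) - 1) * (Ψ w).im
  est_im : ∀ w ∈ UHP, (Ψ w).im ≤ Real.exp (‖Ψ w‖ / w.im) * (F w - w).im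

lemma exp_sub_one_le (x : ℝ) : Real.exp x - 1 ≤ x * Real.exp x := by
  have h := Real.add_one_le_exp (-x)
  have h2 : Real.exp (-x) * Real.exp x = 1 := by rw [← Real.exp_add]; simp
  nlinarith [Real.exp_pos x]

lemma diff_iterate {A : ℂ → ℂ} (hAd : DifferentiableOn ℂ A UHP)
    (hA : ∀ z ∈ UHP, z.im ≤ (A z).im) (k : ℕ) : DifferentiableOn ℂ (A^[k]) UHP :=
  hAd.iterate (fun z hz => lt_of_lt_of_le (show 0 < z.im from hz) (hA z hz)) k

lemma isGen_of_tendsto {ι : Type*} {l : Filter ι} [l.NeBot] {A : ι → ℂ → ℂ} {k : ι → ℕ}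
    {F Ψ : ℂ → ℂ}
    (hAd : ∀ n, DifferentiableOn ℂ (A n) UHP)
    (hA : ∀ n, ∀ z ∈ UHP, z.im ≤ (A n z).im)
    (hk : Tendsto k l atTop)
    (hB : ∀ z ∈ UHP, Tendsto (fun n => (A n)^[k n] z) l (𝓝 (F z)))
    (hΨ : ∀ z ∈ UHP, Tendsto (fun n => (k n : ℂ) * (A n z - z)) l (𝓝 (Ψ z))) :
    IsGen F Ψ := by
  have hkR : Tendsto (fun n => (k n : ℝ)) l atTop := tendsto_natCast_atTop_atTop.comp hk
  set g : ι → ℂ → ℂ := fun n z => (k n : ℂ) * (A n z - z) with hg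
  have hgd : ∀ n, DifferentiableOn ℂ (g n) UHP := fun n =>
    ((hAd n).sub differentiableOn_id).const_mul _
  have hgim : ∀ n z, (g n z).im = k n * (A n z - z).im := by
    intro n z; simp [hg]
  have hgm : ∀ n, ∀ z ∈ UHP, 0 ≤ (g n z).im := by
    intro n z hz; rw [hgim]
    have := hA n z hz
    apply mul_nonneg (by positivity); simp; linarith
  have hgn : ∀ n z, ‖g n z‖ = k n * ‖A n z - z‖ := by
    intro n z; simp [hg]
  have hgl := locunif hgd hgm hΨ
  have hdiff : DifferentiableOn ℂ Ψ UHP := hgl.differentiableOn (Eventually.of_forall hgd) isOpen_UHP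
  have hBd : ∀ n, DifferentiableOn ℂ ((A n)^[k n]) UHP := fun n => diff_iterate (hAd n) (hA n) _
  have hBim : ∀ n, ∀ z ∈ UHP, z.im ≤ ((A n)^[k n] z).im := fun n z hz => iterate_mem (hA n) hz _
  have hBl := locunif hBd (fun n z hz => (show (0:ℝ) ≤ z.im from le_of_lt hz).trans (hBim n z hz)) hB
  have hFim : ∀ z ∈ UHP, z.im ≤ (F z).im := fun z hz =>
    ge_of_tendsto' ((Complex.continuous_im.tendsto _).comp (hB z hz)) (fun n => hBim n z hz)
  have hFm : ∀ z ∈ UHP, F z ∈ UHP := fun z hz => lt_of_lt_of_le (show 0 < z.im from hz) (hFim z hz)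
  have hFd : DifferentiableOn ℂ F UHP := hBl.differentiableOn (Eventually.of_forall hBd) isOpen_UHP
  have hκ : ∀ w ∈ UHP, Tendsto (fun n => k n * ‖A n w - w‖ / w.im) l (𝓝 (‖Ψ w‖ / w.im)) := by
    intro w hw
    have := (hΨ w hw).norm.div_const w.im
    refine this.congr (fun n => ?_)
    simp
  have hΨim : ∀ w ∈ UHP, Tendsto (fun n => (k n : ℝ) * (A n w - w).im) l (𝓝 (Ψ w).im) := by
    intro w hw
    refine ((Complex.continuous_im.tendsto _).comp (hΨ w hw)).congr (fun n => ?_)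
    exact hgim n w
  have hsmall : ∀ z ∈ UHP, Tendsto (fun n => A n z - z) l (𝓝 0) := by
    intro z hz
    have h1 : Tendsto (fun n => ((k n : ℝ) : ℂ)⁻¹ * g n z) l (𝓝 (((0:ℝ):ℂ) * Ψ z)) := by
      apply Tendsto.mul _ (hΨ z hz)
      have := (Complex.continuous_ofReal.tendsto _).comp (hkR.inv_tendsto_atTop)
      refine this.congr (fun n => ?_)
      simp
    simp only [Complex.ofReal_zero, zero_mul] at h1
    refine h1.congr' ?_
    filter_upwards [hk.eventually_gt_atTop 0] with n hn
    have : (k n : ℂ) ≠ 0 := by exact_mod_cast hn.ne'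
    simp [hg]; field_simp
  have hswap : ∀ n z, A n ((A n)^[k n] z) = (A n)^[k n] (A n z) := by
    intro n z
    exact (Function.iterate_succ_apply' (A n) (k n) z).symm.trans
      (Function.iterate_succ_apply (A n) (k n) z)
  have hlim1 : ∀ z ∈ UHP, Tendsto (fun n => g n ((A n)^[k n] z)) l (𝓝 (Ψ (F z))) := by
    intro z hz
    apply hgl.tendsto_comp (hdiff.continuousOn.continuousWithinAt (hFm z hz)) (hFm z hz)
    apply tendsto_nhdsWithin_iff.2 ⟨hB z hz, Eventually.of_forall fun n => ?_⟩
    exact lt_of_lt_of_le (show 0 < z.im from hz) (hBim n z hz)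
  refine ⟨hdiff, ?_, ?_, ?_, ?_, ?_⟩
  · intro z hz
    exact ge_of_tendsto' ((Complex.continuous_im.tendsto _).comp (hΨ z hz)) (fun n => hgm n z hz)
  · intro z hz
    refine tendsto_nhds_unique (hlim1 z hz) ?_
    have hdl := hBl.deriv (Eventually.of_forall hBd) isOpen_UHP
    rw [Metric.tendstoLocallyUniformlyOn_iff] at hdl
    have hcd : ContinuousAt (deriv F) z :=
      ((hFd.deriv isOpen_UHP).continuousOn).continuousAt (isOpen_UHP.mem_nhds hz)
    have hmain : Tendsto (fun n => g n ((A n)^[k n] z) - deriv F z * g n z) l (𝓝 0) := by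
      rw [Metric.tendsto_nhds]
      intro ε hε
      set M := ‖Ψ z‖ + 1
      have hM : 0 < M := by positivity
      set η := ε / (2 * M)
      have hη : 0 < η := by positivity
      obtain ⟨t, ht, hev⟩ := hdl (η/2) (by positivity) z hz
      have ht' : t ∈ 𝓝 z := by rwa [isOpen_UHP.nhdsWithin_eq hz] at ht
      have hc2 := Metric.continuousAt_iff'.1 hcd (η/2) (by positivity)
      obtain ⟨r, hr, hball⟩ := Metric.mem_nhds_iff.1
        (inter_mem (inter_mem ht' hc2) (isOpen_UHP.mem_nhds hz))
      have hevr := (Metric.tendsto_nhds.1 (hsmall z hz)) r hr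
      have hevM := (hΨ z hz).norm.eventually_lt_const (show ‖Ψ z‖ < M by simp [M])
      filter_upwards [hev, hevr, hevM] with n h1 h2 h3
      have h2' : A n z ∈ Metric.ball z r := by
        simpa [dist_eq_norm] using h2
      have hder : ∀ y ∈ Metric.ball z r, HasDerivWithinAt
          (fun y => (A n)^[k n] y - deriv F z * y) (deriv ((A n)^[k n]) y - deriv F z) (Metric.ball z r) y := by
        intro y hy
        have hyU : y ∈ UHP := (hball hy).2
        have := ((hBd n).differentiableAt (isOpen_UHP.mem_nhds hyU)).hasDerivAt
        have h4 : HasDerivAt (fun y => deriv F z * y) (deriv F z) y := by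
          simpa using (hasDerivAt_id y).const_mul (deriv F z)
        exact (this.sub h4).hasDerivWithinAt
      have hbd : ∀ y ∈ Metric.ball z r, ‖deriv ((A n)^[k n]) y - deriv F z‖ ≤ η := by
        intro y hy
        have a1 := h1 y (hball hy).1.1
        have a2 : dist (deriv F y) (deriv F z) < η / 2 := (hball hy).1.2
        simp only [Function.comp] at a1
        have := dist_triangle (deriv ((A n)^[k n]) y) (deriv F y) (deriv F z)
        rw [dist_comm] at a1
        rw [← dist_eq_norm]
        linarith
      have hmv := (convex_ball z r).norm_image_sub_le_of_norm_hasDerivWithin_le hder hbd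
        (Metric.mem_ball_self hr) h2'
      have : g n ((A n)^[k n] z) - deriv F z * g n z = (k n : ℂ) *
          ((A n)^[k n] (A n z) - deriv F z * A n z - ((A n)^[k n] z - deriv F z * z)) := by
        simp only [hg]; rw [hswap]; ring
      rw [this, dist_zero_right, norm_mul]
      have h5 : ‖(k n : ℂ)‖ * (η * ‖A n z - z‖) = η * ‖g n z‖ := by
        rw [hgn]; simp; ring
      calc _ ≤ ‖(k n : ℂ)‖ * (η * ‖A n z - z‖) := by gcongr
        _ = η * ‖g n z‖ := h5
        _ ≤ η * M := by gcongr
        _ < ε := by simp only [η]; field_simp; linarith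
    have := hmain.add ((hΨ z hz).const_mul (deriv F z))
    rw [zero_add] at this
    refine this.congr (fun n => ?_)
    simp only [hg]; ring
  · intro z hz
    have hz' : 0 < z.im := hz
    have h1 := (hlim1 z hz).norm
    have hx : Tendsto (fun n => ‖A n z - z‖ / z.im) l (𝓝 0) := by
      simpa using (hsmall z hz).norm.div_const z.im
    have h2 : Tendsto (fun n => ((A n)^[k n] z).im * ((k n * ‖A n z - z‖ / z.im) *
        Real.exp (‖A n z - z‖ / z.im))) l (𝓝 ((F z).im * ((‖Ψ z‖ / z.im) * Real.exp 0))) :=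
      ((Complex.continuous_im.tendsto _).comp (hB z hz)).mul ((hκ z hz).mul
        ((Real.continuous_exp.tendsto _).comp hx))
    rw [Real.exp_zero, mul_one] at h2
    refine le_of_tendsto_of_tendsto' h1 h2 (fun n => ?_)
    have hBz : 0 < ((A n)^[k n] z).im := hz'.trans_le (hBim n z hz)
    have hAz : 0 < (A n z).im := hz'.trans_le (hA n z hz)
    have hBp : ∀ w ∈ UHP, 0 < ((A n)^[k n] w).im := fun w hw =>
      lt_of_lt_of_le (show 0 < w.im from hw) (hBim n w hw)
    have c1 := norm_sub_le_hypd (hBp _ hAz) hBz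
    have c2 := schwarz_pick (hBd n) hBp hAz hz'
    have c3 := hypd_le_norm hz' (hA n z hz) (le_refl z.im)
    have c4 := Real.exp_le_exp.2 (c2.trans c3)
    have c5 := exp_sub_one_le (‖A n z - z‖ / z.im)
    rw [hgn, hswap]
    calc (k n : ℝ) * ‖(A n)^[k n] (A n z) - (A n)^[k n] z‖
        ≤ k n * (((A n)^[k n] z).im * (‖A n z - z‖ / z.im * Real.exp (‖A n z - z‖ / z.im))) := by
          gcongr
          refine c1.trans ?_
          gcongr
          linarith
      _ = _ := by ring
  · intro w hw
    have h1 : Tendsto (fun n => ‖(A n)^[k n] w - w - k n * (A n w - w)‖) l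
        (𝓝 ‖F w - w - Ψ w‖) := (((hB w hw).sub_const w).sub (hΨ w hw)).norm
    have h2 : Tendsto (fun n => (Real.exp (k n * ‖A n w - w‖ / w.im) - 1) * (k n * (A n w - w).im))
        l (𝓝 ((Real.exp (‖Ψ w‖ / w.im) - 1) * (Ψ w).im)) :=
      (((Real.continuous_exp.tendsto _).comp (hκ w hw)).sub_const 1).mul (hΨim w hw)
    exact le_of_tendsto_of_tendsto' h1 h2 (fun n => disc_est (hAd n) (hA n) hw _)
  · intro w hw
    have h2 : Tendsto (fun n => Real.exp (k n * ‖A n w - w‖ / w.im) * ((A n)^[k n] w - w).im)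
        l (𝓝 (Real.exp (‖Ψ w‖ / w.im) * (F w - w).im)) :=
      ((Real.continuous_exp.tendsto _).comp (hκ w hw)).mul
        ((Complex.continuous_im.tendsto _).comp ((hB w hw).sub_const w))
    exact le_of_tendsto_of_tendsto' (hΨim w hw) h2 (fun n => disc_est_im (hAd n) (hA n) hw _)

lemma uniq_step0 {F : ℂ → ℂ} (hFd : DifferentiableOn ℂ F UHP)
    (hF : ∀ z ∈ UHP, z.im ≤ (F z).im)
    (hFi : Tendsto (fun y : ℝ => ‖F (y * Complex.I) - y * Complex.I‖ / y) atTop (𝓝 0))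
    {z : ℂ} (hz : z ∈ UHP) {ε : ℝ} (hε : 0 < ε) :
    ∃ n : ℕ, (F (F^[n] z) - F^[n] z).im < ε * (F^[n] z).im := by
  by_contra! hcon
  have hz' : 0 < z.im := hz
  have hgrow : ∀ n : ℕ, (1 + ε) ^ n * z.im ≤ (F^[n] z).im := by
    intro n
    induction n with
    | zero => simp
    | succ n ih =>
      rw [Function.iterate_succ_apply']
      have := hcon n
      simp only [Complex.sub_im] at this
      rw [pow_succ]
      nlinarith
  have hlog : 0 < Real.log (1 + ε) := Real.log_pos (by linarith)
  obtain ⟨Y, hY1, hY2⟩ := ((hFi.eventually_lt_const (show 0 < Real.log (1+ε) / 2 by positivity)).and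
    (eventually_gt_atTop 0)).exists
  set w : ℂ := Y * Complex.I with hw
  have hwim : w.im = Y := by simp [hw]
  have hw' : 0 < w.im := by rw [hwim]; exact hY2
  have hm : ∀ n, ∀ x ∈ UHP, 0 < (F^[n] x).im := fun n x hx =>
    lt_of_lt_of_le (show 0 < x.im from hx) (iterate_mem hF hx n)
  have hd : ∀ n : ℕ, hypd (F^[n] z) z ≤ 2 * hypd z w + n * (Real.log (1+ε) / 2) := by
    intro n
    have h1 := hypd_iterate hFd hF (w := w) hw' n
    have h2 := schwarz_pick (diff_iterate hFd hF n) (hm n) hz' hw'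
    have h3 := hypd_triangle (hm n z hz) (hm n w hw') hz'
    have h4 := hypd_triangle (hm n w hw') hw' hz'
    rw [hwim] at h1
    have h5 : (n:ℝ) * (‖F w - w‖ / Y) ≤ n * (Real.log (1+ε) / 2) := by gcongr
    rw [hypd_comm (z := w) (w := z)] at h4
    linarith
  have hN : ∀ n : ℕ, n * Real.log (1+ε) ≤ 2 * hypd z w + n * (Real.log (1+ε) / 2) := by
    intro n
    have h1 := im_le_hypd (hm n z hz) hz'
    have h2 := (hgrow n).trans h1
    have h3 : (1 + ε)^n ≤ Real.exp (hypd (F^[n] z) z) := by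
      rw [mul_comm] at h2; exact le_of_mul_le_mul_left h2 hz'
    have h4 := Real.log_le_log (by positivity) h3
    rw [Real.log_exp, Real.log_pow] at h4
    exact h4.trans (hd n)
  obtain ⟨n, hn⟩ := exists_nat_gt (2 * hypd z w / (Real.log (1+ε) / 2))
  rw [div_lt_iff₀ (by positivity)] at hn
  have := hN n
  linarith

lemma IsGen.zero_of_zero {F Ψ : ℂ → ℂ} (h : IsGen F Ψ) {w : ℂ} (hw : w ∈ UHP) (h0 : Ψ w = 0)
    {z : ℂ} (hz : z ∈ UHP) : Ψ z = 0 := by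
  have := harnack h.diff h.im_nonneg hz hw
  rw [h0] at this
  simpa using this

lemma uniq_step1 {F Ψ₁ Ψ₂ : ℂ → ℂ} (hFd : DifferentiableOn ℂ F UHP)
    (hF : ∀ z ∈ UHP, z.im ≤ (F z).im)
    (hFi : Tendsto (fun y : ℝ => ‖F (y * Complex.I) - y * Complex.I‖ / y) atTop (𝓝 0))
    (h1 : IsGen F Ψ₁) (h2 : IsGen F Ψ₂) {z : ℂ} (hz : z ∈ UHP) :
    (Ψ₂ z * (starRingEnd ℂ) (Ψ₁ z)).im = 0 := by
  by_contra hD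
  set v := Ψ₁ z with hv
  set u := Ψ₂ z with hu
  set D := (u * (starRingEnd ℂ) v).im with hDdef
  have hmem : ∀ n : ℕ, 0 < (F^[n] z).im := fun n =>
    lt_of_lt_of_le (show 0 < z.im from hz) (iterate_mem hF hz n)
  have hc : ∀ n : ℕ, ∃ c : ℂ, Ψ₁ (F^[n] z) = c * v ∧ Ψ₂ (F^[n] z) = c * u := by
    intro n
    induction n with
    | zero => exact ⟨1, by simp [hv], by simp [hu]⟩
    | succ n ih =>
      obtain ⟨c, hc1, hc2⟩ := ih
      refine ⟨deriv F (F^[n] z) * c, ?_, ?_⟩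
      · rw [Function.iterate_succ_apply', h1.comm _ (hmem n), hc1]; ring
      · rw [Function.iterate_succ_apply', h2.comm _ (hmem n), hc2]; ring
  have hκ : ∀ Ψ : ℂ → ℂ, IsGen F Ψ → ∀ n : ℕ, ‖Ψ (F^[n] z)‖ / (F^[n] z).im ≤ ‖Ψ z‖ / z.im := by
    intro Ψ hΨ n
    induction n with
    | zero => simp
    | succ n ih =>
      refine le_trans ?_ ih
      have := hΨ.contr _ (hmem n)
      have h3 := hmem (n+1)
      rw [Function.iterate_succ_apply'] at h3 ⊢
      rw [div_le_iff₀ h3]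
      linarith
  set M := Real.exp (‖v‖ / z.im) + Real.exp (‖u‖ / z.im) with hM
  have hMpos : 0 < M := by positivity
  have hu0 : u ≠ 0 := by rintro h; apply hD; simp [hDdef, h]
  have hv0 : v ≠ 0 := by rintro h; apply hD; simp [hDdef, h]
  have huv : u ≠ v := by
    rintro h; apply hD; rw [hDdef, h, Complex.mul_conj]; simp
  have hun : 0 < ‖u‖ := norm_pos_iff.2 hu0
  have huvn : 0 < ‖u - v‖ := norm_pos_iff.2 (sub_ne_zero.2 huv)
  have hcont : Continuous (fun t : ℝ => (Real.exp (t * ‖u‖) - 1) * ‖u‖ + (Real.exp (t * ‖v‖) - 1) * ‖v‖) := by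
    fun_prop
  have hev := (hcont.tendsto 0).eventually_lt_const (u := ‖u - v‖) (by simpa using huvn)
  obtain ⟨δ, hδ, hball⟩ := Metric.eventually_nhds_iff.1 hev
  have hDpos : 0 < |D| := abs_pos.2 hD
  set ε := δ * |D| / (2 * M * (‖u‖ + ‖v‖)) with hε
  have hεpos : 0 < ε := by positivity
  obtain ⟨n, hn⟩ := uniq_step0 hFd hF hFi hz hεpos
  obtain ⟨c, hc1, hc2⟩ := hc n
  set w := F^[n] z with hw
  have hy : 0 < w.im := hmem n
  have hc0 : c ≠ 0 := by
    rintro rfl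
    apply hv0
    exact h1.zero_of_zero (hmem n) (by simpa using hc1) hz
  have hcn : 0 < ‖c‖ := norm_pos_iff.2 hc0
  have hF0 : 0 ≤ (F w - w).im := by simp only [Complex.sub_im]; linarith [hF w hy]
  have im_bd : ∀ Ψ : ℂ → ℂ, IsGen F Ψ → Real.exp (‖Ψ z‖ / z.im) ≤ M → |(Ψ w).im| ≤ M * (ε * w.im) := by
    intro Ψ hΨ hle
    rw [abs_of_nonneg (hΨ.im_nonneg w hy)]
    refine (hΨ.est_im w hy).trans ?_
    have := Real.exp_le_exp.2 (hκ Ψ hΨ n)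
    gcongr
    exact this.trans hle
  have b1 := im_bd Ψ₁ h1 (by rw [hM]; linarith [Real.exp_pos (‖u‖ / z.im)])
  have b2 := im_bd Ψ₂ h2 (by rw [hM]; linarith [Real.exp_pos (‖v‖ / z.im)])
  rw [hc1] at b1
  rw [hc2] at b2
  have hid : (((c * v).im : ℝ) : ℂ) * u - (((c * u).im : ℝ) : ℂ) * v = - (starRingEnd ℂ) c * (D : ℂ) := by
    apply Complex.ext <;> simp [hDdef] <;> ring
  have hnorm : ‖c‖ * |D| ≤ M * (ε * w.im) * (‖u‖ + ‖v‖) := by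
    have := congrArg norm hid
    rw [norm_mul, norm_neg, RCLike.norm_conj, Complex.norm_real, Real.norm_eq_abs] at this
    rw [← this]
    refine (norm_sub_le _ _).trans ?_
    rw [norm_mul, norm_mul, Complex.norm_real, Complex.norm_real, Real.norm_eq_abs, Real.norm_eq_abs]
    nlinarith [norm_nonneg u, norm_nonneg v]
  set t := ‖c‖ / w.im with ht
  have htpos : 0 < t := by positivity
  have htδ : t < δ := by
    have : t * |D| ≤ δ / 2 * |D| := by
      rw [ht, div_mul_eq_mul_div, div_le_iff₀ hy]
      refine hnorm.trans (le_of_eq ?_)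
      rw [hε]; field_simp
    have := le_of_mul_le_mul_right this hDpos
    linarith
  have hlt := hball (show dist t 0 < δ by rw [dist_zero_right, Real.norm_eq_abs, abs_of_pos htpos]; exact htδ)
  have e1 := h1.est w hy
  have e2 := h2.est w hy
  rw [hc1] at e1
  rw [hc2] at e2
  have i1 := (le_abs_self _).trans (Complex.abs_im_le_norm (c * v))
  have i2 := (le_abs_self _).trans (Complex.abs_im_le_norm (c * u))
  have k1 : ‖c * v‖ / w.im = t * ‖v‖ := by rw [norm_mul, ht]; ring
  have k2 : ‖c * u‖ / w.im = t * ‖u‖ := by rw [norm_mul, ht]; ring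
  rw [k1] at e1
  rw [k2] at e2
  have x1 : 0 ≤ Real.exp (t * ‖v‖) - 1 := by
    have := Real.one_le_exp (show 0 ≤ t * ‖v‖ by positivity); linarith
  have x2 : 0 ≤ Real.exp (t * ‖u‖) - 1 := by
    have := Real.one_le_exp (show 0 ≤ t * ‖u‖ by positivity); linarith
  have e1' := e1.trans (mul_le_mul_of_nonneg_left i1 x1)
  have e2' := e2.trans (mul_le_mul_of_nonneg_left i2 x2)
  have hfin : ‖c‖ * ‖u - v‖ ≤ ‖c‖ * ((Real.exp (t * ‖u‖) - 1) * ‖u‖ + (Real.exp (t * ‖v‖) - 1) * ‖v‖) := by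
    rw [← norm_mul]
    have : c * (u - v) = (F w - w - c * v) - (F w - w - c * u) := by ring
    rw [this]
    refine (norm_sub_le _ _).trans ?_
    rw [norm_mul] at e1' e2'
    linarith
  have := le_of_mul_le_mul_left hfin hcn
  linarith

lemma tendsto_exp_aux {Ψ : ℂ → ℂ}
    (hi : Tendsto (fun y : ℝ => ‖Ψ (y * Complex.I)‖ / y) atTop (𝓝 0)) :
    Tendsto (fun y : ℝ => Real.exp (‖Ψ (y * Complex.I)‖ / y) - 1) atTop (𝓝 0) := by
  have := ((Real.continuous_exp.tendsto _).comp hi).sub_const 1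
  simpa using this

lemma uniq_gen {F Ψ₁ Ψ₂ : ℂ → ℂ} (hFd : DifferentiableOn ℂ F UHP)
    (hF : ∀ z ∈ UHP, z.im ≤ (F z).im)
    (hFi : Tendsto (fun y : ℝ => ‖F (y * Complex.I) - y * Complex.I‖ / y) atTop (𝓝 0))
    (h1 : IsGen F Ψ₁) (h2 : IsGen F Ψ₂)
    (hi1 : Tendsto (fun y : ℝ => ‖Ψ₁ (y * Complex.I)‖ / y) atTop (𝓝 0))
    (hi2 : Tendsto (fun y : ℝ => ‖Ψ₂ (y * Complex.I)‖ / y) atTop (𝓝 0))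
    {z : ℂ} (hz : z ∈ UHP) : Ψ₁ z = Ψ₂ z := by
  by_cases hzero : ∃ w ∈ UHP, Ψ₁ w = 0
  · obtain ⟨w, hw, hw0⟩ := hzero
    have hall : Ψ₁ z = 0 := h1.zero_of_zero hw hw0 hz
    have e1 := h1.est z hz
    rw [hall] at e1
    simp only [sub_zero, Complex.zero_im, mul_zero, norm_le_zero_iff] at e1
    have e2 := h2.est_im z hz
    rw [e1] at e2
    simp only [Complex.zero_im, mul_zero] at e2
    have e3 := h2.est z hz
    have e4 : (Ψ₂ z).im = 0 := le_antisymm e2 (h2.im_nonneg z hz)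
    rw [e1, e4] at e3
    simp at e3
    rw [hall, e3]
  · push Not at hzero
    set q : ℂ → ℂ := fun w => Ψ₂ w / Ψ₁ w with hq
    have hqd : DifferentiableOn ℂ q UHP := h2.diff.div h1.diff hzero
    have hqim : ∀ w ∈ UHP, (q w).im = 0 := by
      intro w hw
      have := uniq_step1 hFd hF hFi h1 h2 hw
      simp only [hq, div_eq_mul_inv, Complex.inv_def]
      rw [← mul_assoc, Complex.im_mul_ofReal, this, zero_mul]
    have hqc : ∀ w ∈ UHP, q w = q z := by
      intro w hw
      have := harnack hqd (fun w hw => (hqim w hw).ge) hw hz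
      rw [hqim z hz, zero_mul, norm_le_zero_iff, sub_eq_zero] at this
      exact this
    have hbd : ∀ᶠ y : ℝ in atTop, ‖1 - q z‖ ≤ (Real.exp (‖Ψ₁ (y * Complex.I)‖ / y) - 1) +
        (Real.exp (‖Ψ₂ (y * Complex.I)‖ / y) - 1) * ‖q z‖ := by
      filter_upwards [eventually_gt_atTop 0] with y hy
      set w : ℂ := y * Complex.I with hw
      have hwim : w.im = y := by simp [hw]
      have hwU : w ∈ UHP := by change 0 < w.im; rw [hwim]; exact hy
      have hne := hzero w hwU
      have hp : 0 < ‖Ψ₁ w‖ := norm_pos_iff.2 hne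
      have h2w : Ψ₂ w = q z * Ψ₁ w := by
        rw [← hqc w hwU]; simp only [hq]; field_simp
      have e1 := h1.est w hwU
      have e2 := h2.est w hwU
      rw [hwim] at e1 e2
      have x1 : 0 ≤ Real.exp (‖Ψ₁ w‖ / y) - 1 := by
        have := Real.one_le_exp (show 0 ≤ ‖Ψ₁ w‖ / y by positivity); linarith
      have x2 : 0 ≤ Real.exp (‖Ψ₂ w‖ / y) - 1 := by
        have := Real.one_le_exp (show 0 ≤ ‖Ψ₂ w‖ / y by positivity); linarith
      have i1 := (le_abs_self _).trans (Complex.abs_im_le_norm (Ψ₁ w))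
      have i2 := (le_abs_self _).trans (Complex.abs_im_le_norm (Ψ₂ w))
      have e1' := e1.trans (mul_le_mul_of_nonneg_left i1 x1)
      have e2' := e2.trans (mul_le_mul_of_nonneg_left i2 x2)
      have hn2 : ‖Ψ₂ w‖ = ‖q z‖ * ‖Ψ₁ w‖ := by rw [h2w, norm_mul]
      refine le_of_mul_le_mul_right ?_ hp
      rw [← norm_mul]
      have : (1 - q z) * Ψ₁ w = (F w - w - Ψ₂ w) - (F w - w - Ψ₁ w) := by rw [h2w]; ring
      rw [this]
      refine (norm_sub_le _ _).trans ?_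
      calc _ ≤ _ := add_le_add e2' e1'
        _ = _ := by nth_rewrite 2 [hn2]; ring
    have hlim : Tendsto (fun y : ℝ => (Real.exp (‖Ψ₁ (y * Complex.I)‖ / y) - 1) +
        (Real.exp (‖Ψ₂ (y * Complex.I)‖ / y) - 1) * ‖q z‖) atTop (𝓝 (0 + 0 * ‖q z‖)) :=
      (tendsto_exp_aux hi1).add ((tendsto_exp_aux hi2).mul_const _)
    have := ge_of_tendsto hlim hbd
    simp only [zero_mul, add_zero, norm_le_zero_iff, sub_eq_zero] at this
    have hne := hzero z hz
    simp only [hq] at this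
    field_simp at this
    exact this

lemma chernoff {ι : Type*} {l : Filter ι} [l.NeBot] {A : ι → ℂ → ℂ} {k : ι → ℕ}
    {Ψ : ℂ → ℂ} {F : ℝ → ℂ → ℂ}
    (hAd : ∀ n, DifferentiableOn ℂ (A n) UHP)
    (hA : ∀ n, ∀ z ∈ UHP, z.im ≤ (A n z).im)
    (hk : Tendsto k l atTop)
    (hΨ : ∀ z ∈ UHP, Tendsto (fun n => (k n : ℂ) * (A n z - z)) l (𝓝 (Ψ z)))
    (hF0 : ∀ z ∈ UHP, F 0 z = z)
    (hFm : ∀ t : ℝ, 0 ≤ t → ∀ z ∈ UHP, 0 < (F t z).im)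
    (hFder : ∀ z ∈ UHP, ∀ t : ℝ, 0 ≤ t → HasDerivWithinAt (fun s => F s z) (Ψ (F t z)) (Ici 0) t)
    {z : ℂ} (hz : z ∈ UHP) : Tendsto (fun n => (A n)^[k n] z) l (𝓝 (F 1 z)) := by
  set g : ι → ℂ → ℂ := fun n z => (k n : ℂ) * (A n z - z) with hg
  have hgd : ∀ n, DifferentiableOn ℂ (g n) UHP := fun n =>
    ((hAd n).sub differentiableOn_id).const_mul _
  have hgm : ∀ n, ∀ z ∈ UHP, 0 ≤ (g n z).im := by
    intro n z hz
    have h1 : (g n z).im = k n * (A n z - z).im := by simp [hg]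
    rw [h1]
    have := hA n z hz
    apply mul_nonneg (by positivity); simp; linarith
  have hgl := locunif hgd hgm hΨ
  have hdiff : DifferentiableOn ℂ Ψ UHP := hgl.differentiableOn (Eventually.of_forall hgd) isOpen_UHP
  set p : ℝ → ℂ := fun s => F s z with hp
  have hpc : ContinuousOn p (Icc 0 1) := fun s hs =>
    ((hFder z hz s hs.1).continuousWithinAt).mono (fun x hx => hx.1)
  have hpU : ∀ s ∈ Icc (0:ℝ) 1, p s ∈ UHP := fun s hs => hFm s hs.1 z hz
  have hKc : IsCompact (p '' Icc 0 1) := isCompact_Icc.image_of_continuousOn hpc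
  have hKU : p '' Icc 0 1 ⊆ UHP := by rintro _ ⟨s, hs, rfl⟩; exact hpU s hs
  obtain ⟨m, hm, hmK⟩ : ∃ m : ℝ, 0 < m ∧ ∀ s ∈ Icc (0:ℝ) 1, m ≤ (p s).im := by
    obtain ⟨s, hs, hmin⟩ := isCompact_Icc.exists_isMinOn (nonempty_Icc.2 (zero_le_one (α := ℝ)))
      (Complex.continuous_im.comp_continuousOn hpc)
    exact ⟨(p s).im, hpU s hs, fun t ht => hmin ht⟩
  have hφc : ContinuousOn (fun s => Ψ (p s)) (Icc 0 1) :=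
    hdiff.continuousOn.comp hpc hpU
  have hφu := isCompact_Icc.uniformContinuousOn_of_continuous hφc
  have hgu : TendstoUniformlyOn g Ψ l (p '' Icc 0 1) :=
    (tendstoLocallyUniformlyOn_iff_forall_isCompact isOpen_UHP).1 hgl _ hKU hKc
  have hmA : ∀ n, ∀ x ∈ UHP, 0 < (A n x).im := fun n x hx =>
    lt_of_lt_of_le (show 0 < x.im from hx) (hA n x hx)
  have main : ∀ ε : ℝ, 0 < ε → ∀ᶠ n in l, hypd ((A n)^[k n] z) (p 1) ≤ 2 * ε / m := by
    intro ε hε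
    obtain ⟨δ, hδ, hu⟩ := Metric.uniformContinuousOn_iff.1 hφu ε hε
    have ev1 := Metric.tendstoUniformlyOn_iff.1 hgu ε hε
    have hkR : Tendsto (fun n => (k n : ℝ)) l atTop := tendsto_natCast_atTop_atTop.comp hk
    have ev2 := (hkR.inv_tendsto_atTop).eventually_lt_const hδ
    filter_upwards [ev1, ev2, hk.eventually_gt_atTop 0] with n h1 h2 h3
    simp only [Pi.inv_apply] at h2
    have hkp : (0:ℝ) < k n := by exact_mod_cast h3
    have hkc : (k n : ℂ) ≠ 0 := by exact_mod_cast h3.ne'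
    have step : ∀ s ∈ Icc (0:ℝ) 1, s + (k n : ℝ)⁻¹ ∈ Icc (0:ℝ) 1 →
        hypd (A n (p s)) (p (s + (k n : ℝ)⁻¹)) ≤ 2 * ε / (k n * m) := by
      intro s hs hs'
      have hle : s ≤ s + (k n : ℝ)⁻¹ := by have : 0 < (k n : ℝ)⁻¹ := by positivity
                                           linarith
      set s' := s + (k n : ℝ)⁻¹ with hs'def
      have hss : Icc s s' ⊆ Icc 0 1 := Icc_subset_Icc hs.1 hs'.2
      have hd : ∀ x ∈ Icc s s', HasDerivWithinAt (fun x : ℝ => p x - (x : ℂ) * Ψ (p s))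
          (Ψ (p x) - Ψ (p s)) (Icc s s') x := by
        intro x hx
        have a1 := (hFder z hz x (hss hx).1).mono (fun y hy => (hss hy).1 : Icc s s' ⊆ Ici 0)
        have a2 : HasDerivWithinAt (fun x : ℝ => (x : ℂ) * Ψ (p s)) (Ψ (p s)) (Icc s s') x := by
          have := (Complex.ofRealCLM.hasDerivAt (x := x)).mul_const (Ψ (p s))
          simpa using this.hasDerivWithinAt
        exact a1.sub a2
      have hb : ∀ x ∈ Icc s s', ‖Ψ (p x) - Ψ (p s)‖ ≤ ε := by
        intro x hx
        rw [← dist_eq_norm]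
        refine (hu x (hss hx) s hs ?_).le
        rw [Real.dist_eq, abs_of_nonneg (by linarith [hx.1])]
        have := hx.2
        linarith
      have mv := (convex_Icc s s').norm_image_sub_le_of_norm_hasDerivWithin_le hd hb
        (left_mem_Icc.2 hle) (right_mem_Icc.2 hle)
      have hn1 : ‖s' - s‖ = (k n : ℝ)⁻¹ := by
        rw [hs'def, add_sub_cancel_left, Real.norm_eq_abs, abs_of_pos (by positivity)]
      rw [hn1] at mv
      have b1 := (h1 (p s) ⟨s, hs, rfl⟩).le
      rw [dist_comm, dist_eq_norm] at b1
      have b2 : ‖A n (p s) - p s - (k n : ℂ)⁻¹ * Ψ (p s)‖ ≤ ε * (k n : ℝ)⁻¹ := by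
        have : A n (p s) - p s - (k n : ℂ)⁻¹ * Ψ (p s) = (k n : ℂ)⁻¹ * (g n (p s) - Ψ (p s)) := by
          simp only [hg]; field_simp
        rw [this, norm_mul, norm_inv, Complex.norm_natCast, mul_comm]
        gcongr
      have hnorm : ‖A n (p s) - p s'‖ ≤ 2 * ε * (k n : ℝ)⁻¹ := by
        have : A n (p s) - p s' = (A n (p s) - p s - (k n : ℂ)⁻¹ * Ψ (p s)) -
            ((p s' - s' * Ψ (p s)) - (p s - s * Ψ (p s))) := by
          rw [hs'def]; push_cast; ring
        rw [this]
        refine (norm_sub_le _ _).trans ?_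
        linarith
      refine (hypd_le_norm hm ((hmK s hs).trans (hA n _ (hpU s hs))) (hmK s' hs')).trans ?_
      rw [div_le_div_iff₀ hm (by positivity)]
      calc _ ≤ 2 * ε * (k n : ℝ)⁻¹ * (k n * m) := by gcongr
        _ = _ := by field_simp
    have ind : ∀ j : ℕ, j ≤ k n → hypd ((A n)^[j] z) (p (j / k n)) ≤ j * (2 * ε / (k n * m)) := by
      intro j
      induction j with
      | zero =>
        intro _
        simp only [Function.iterate_zero, id, hp, Nat.cast_zero, zero_div, zero_mul, hF0 z hz, hypd_self]
        exact le_refl _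
      | succ j ih =>
        intro hj
        have hi := ih (by omega)
        have hjle : ((j:ℝ)+1) ≤ k n := by exact_mod_cast hj
        have hs : (j / k n : ℝ) ∈ Icc (0:ℝ) 1 :=
          ⟨by positivity, by rw [div_le_one hkp]; linarith⟩
        have heq : ((j+1 : ℕ) / k n : ℝ) = j / k n + (k n : ℝ)⁻¹ := by push_cast; ring
        have hs' : (j / k n : ℝ) + (k n : ℝ)⁻¹ ∈ Icc (0:ℝ) 1 := by
          rw [← heq]; exact ⟨by positivity, by rw [div_le_one hkp]; push_cast; linarith⟩
        rw [heq, Function.iterate_succ_apply']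
        have hzj : (A n)^[j] z ∈ UHP := lt_of_lt_of_le (show 0 < z.im from hz) (iterate_mem (hA n) hz j)
        have t1 := hypd_triangle (hmA n _ hzj) (hmA n _ (hpU _ hs)) (hpU _ hs')
        have t2 := schwarz_pick (hAd n) (hmA n) hzj (hpU _ hs)
        have t3 := step _ hs hs'
        push_cast
        linarith
    have := ind (k n) le_rfl
    rw [div_self hkp.ne'] at this
    refine this.trans (le_of_eq ?_)
    field_simp
  have h1U : p 1 ∈ UHP := hpU 1 ⟨zero_le_one, le_rfl⟩
  have hzn : ∀ n, 0 < ((A n)^[k n] z).im := fun n =>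
    lt_of_lt_of_le (show 0 < z.im from hz) (iterate_mem (hA n) hz _)
  have hlim : Tendsto (fun n => hypd ((A n)^[k n] z) (p 1)) l (𝓝 0) := by
    rw [Metric.tendsto_nhds]
    intro ε hε
    filter_upwards [main (ε * m / 4) (by positivity)] with n hn
    rw [dist_zero_right, Real.norm_eq_abs, abs_of_nonneg (hypd_nonneg (hzn n) h1U)]
    refine hn.trans_lt ?_
    rw [div_lt_iff₀ hm]; nlinarith [mul_pos hε hm]
  have hlim2 : Tendsto (fun n => (p 1).im * (Real.exp (hypd ((A n)^[k n] z) (p 1)) - 1)) l (𝓝 0) := by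
    have := (((Real.continuous_exp.tendsto _).comp hlim).sub_const 1).const_mul (p 1).im
    simpa using this
  rw [tendsto_iff_norm_sub_tendsto_zero]
  exact squeeze_zero (fun n => norm_nonneg _) (fun n => norm_sub_le_hypd (hzn n) h1U) hlim2

lemma sub_ofReal_ne {z : ℂ} (hz : z.im ≠ 0) (x : ℝ) : z - (x : ℂ) ≠ 0 := by
  intro h
  have := congrArg Complex.im h
  simp at this
  exact hz this

lemma continuous_res {z : ℂ} (hz : z.im ≠ 0) : Continuous (fun x : ℝ => (z - (x : ℂ))⁻¹) := by
  apply Continuous.inv₀ (by fun_prop) (sub_ofReal_ne hz)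

lemma norm_res_le {z : ℂ} (hz : z.im ≠ 0) (x : ℝ) : ‖(z - (x : ℂ))⁻¹‖ ≤ |z.im|⁻¹ := by
  rw [norm_inv]
  have h := Complex.abs_im_le_norm (z - (x : ℂ))
  simp only [Complex.sub_im, Complex.ofReal_im, sub_zero] at h
  have : 0 < |z.im| := abs_pos.2 hz
  gcongr

lemma tendsto_res {z : ℂ} (hz : z.im ≠ 0) :
    Tendsto (fun x : ℝ => (z - (x : ℂ))⁻¹) (coclosedCompact ℝ) (𝓝 0) := by
  rw [coclosedCompact_eq_cocompact]
  apply tendsto_inv₀_cobounded.comp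
  rw [← tendsto_norm_atTop_iff_cobounded]
  have h1 : Tendsto (fun x : ℝ => ‖x‖ - ‖z‖) (cocompact ℝ) atTop :=
    tendsto_atTop_add_const_right _ _ tendsto_norm_cocompact_atTop
  refine tendsto_atTop_mono (fun x => ?_) h1
  have := norm_sub_norm_le (x : ℂ) z
  rw [Complex.norm_real] at this
  rw [norm_sub_rev]; exact this

/-- The resolvent function as a continuous function on the one-point compactification. -/
noncomputable def resF (z : ℂ) (hz : z.im ≠ 0) : C(OnePoint ℝ, ℂ) :=
  OnePoint.continuousMapMk ⟨fun x : ℝ => (z - (x : ℂ))⁻¹, continuous_res hz⟩ 0 (tendsto_res hz)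

lemma resF_coe (z : ℂ) (hz : z.im ≠ 0) (x : ℝ) : resF z hz (x : OnePoint ℝ) = (z - (x : ℂ))⁻¹ := rfl

lemma resF_infty (z : ℂ) (hz : z.im ≠ 0) : resF z hz OnePoint.infty = 0 := rfl

lemma resF_ext {f g : C(OnePoint ℝ, ℂ)} (h0 : f OnePoint.infty = g OnePoint.infty)
    (h : ∀ x : ℝ, f (x : OnePoint ℝ) = g (x : OnePoint ℝ)) : f = g := by
  ext x
  induction x using OnePoint.rec with
  | infty => exact h0
  | coe x => exact h x

lemma resF_dist {z w : ℂ} (hz : z.im ≠ 0) (hw : w.im ≠ 0) :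
    ‖resF w hw - resF z hz‖ ≤ ‖z - w‖ * (|w.im|⁻¹ * |z.im|⁻¹) := by
  rw [ContinuousMap.norm_le _ (by positivity)]
  intro x
  induction x using OnePoint.rec with
  | infty => simp only [ContinuousMap.sub_apply, resF_infty, sub_zero, norm_zero]; positivity
  | coe x =>
    rw [ContinuousMap.sub_apply, resF_coe, resF_coe]
    have : (w - (x : ℂ))⁻¹ - (z - (x : ℂ))⁻¹ = (z - w) * ((w - (x : ℂ))⁻¹ * (z - (x : ℂ))⁻¹) := by
      have h1 := sub_ofReal_ne hz x
      have h2 := sub_ofReal_ne hw x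
      field_simp
      ring
    rw [this, norm_mul, norm_mul]
    gcongr
    · exact norm_res_le hw x
    · exact norm_res_le hz x

lemma im_add_ne {z : ℂ} (hz : z.im ≠ 0) (t : ℝ) : (z + (t : ℂ)).im ≠ 0 := by simpa using hz

lemma resF_tendsto {z : ℂ} (hz : z.im ≠ 0) :
    Tendsto (fun m : ℕ => resF (z + ((1 / ((m:ℝ) + 1) : ℝ) : ℂ)) (im_add_ne hz _)) atTop
      (𝓝 (resF z hz)) := by
  rw [tendsto_iff_norm_sub_tendsto_zero]
  have h := (tendsto_one_div_add_atTop_nhds_zero_nat (𝕜 := ℝ)).mul_const (|z.im|⁻¹ * |z.im|⁻¹)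
  rw [zero_mul] at h
  refine squeeze_zero (fun m => norm_nonneg _) (fun m => (resF_dist hz (im_add_ne hz _)).trans ?_) h
  simp only [Complex.add_im, Complex.ofReal_im, add_zero]
  gcongr
  rw [sub_add_cancel_left, norm_neg, Complex.norm_real, Real.norm_eq_abs, abs_of_pos (by positivity)]

/-- The generating set of resolvents. -/
def resSet : Set C(OnePoint ℝ, ℂ) := insert 1 {f | ∃ (z : ℂ) (hz : z.im ≠ 0), f = resF z hz}

/-- The closed span of the resolvents. -/
noncomputable def resSpan : Submodule ℂ C(OnePoint ℝ, ℂ) :=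
  (Submodule.span ℂ resSet).topologicalClosure

lemma isClosed_resSpan : IsClosed (resSpan : Set C(OnePoint ℝ, ℂ)) :=
  Submodule.isClosed_topologicalClosure _

lemma span_le_resSpan : Submodule.span ℂ resSet ≤ resSpan := Submodule.le_topologicalClosure _

lemma resF_mem {z : ℂ} (hz : z.im ≠ 0) : resF z hz ∈ resSpan :=
  span_le_resSpan (Submodule.subset_span (Or.inr ⟨z, hz, rfl⟩))

lemma one_mem_resSpan : (1 : C(OnePoint ℝ, ℂ)) ∈ resSpan :=
  span_le_resSpan (Submodule.subset_span (Or.inl rfl))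

lemma resF_mul_mem' {z w : ℂ} (hz : z.im ≠ 0) (hw : w.im ≠ 0) (hne : z ≠ w) :
    resF z hz * resF w hw ∈ resSpan := by
  have : resF z hz * resF w hw = (w - z)⁻¹ • (resF z hz - resF w hw) := by
    apply resF_ext
    · simp [resF_infty]
    · intro x
      simp only [ContinuousMap.mul_apply, ContinuousMap.smul_apply, ContinuousMap.sub_apply, resF_coe, smul_eq_mul]
      have h1 := sub_ofReal_ne hz x
      have h2 := sub_ofReal_ne hw x
      have h3 : w - z ≠ 0 := sub_ne_zero.2 hne.symm
      field_simp
      ring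
  rw [this]
  exact Submodule.smul_mem _ _ (Submodule.sub_mem _ (resF_mem hz) (resF_mem hw))

lemma resF_mul_mem {z w : ℂ} (hz : z.im ≠ 0) (hw : w.im ≠ 0) :
    resF z hz * resF w hw ∈ resSpan := by
  by_cases hne : z = w
  · subst hne
    have := (resF_tendsto hz).const_mul (resF z hz)
    refine isClosed_resSpan.mem_of_tendsto this (Eventually.of_forall fun m => ?_)
    apply resF_mul_mem'
    intro h
    have h2 : (((1 / ((m:ℝ) + 1) : ℝ) : ℂ)) = 0 := by linear_combination -h
    rw [Complex.ofReal_eq_zero] at h2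
    have : (0:ℝ) < 1 / ((m:ℝ) + 1) := by positivity
    linarith
  · exact resF_mul_mem' hz hw hne

lemma resSpan_mul {f g : C(OnePoint ℝ, ℂ)} (hf : f ∈ resSpan) (hg : g ∈ resSpan) :
    f * g ∈ resSpan := by
  have key : ∀ a ∈ Submodule.span ℂ resSet, ∀ b ∈ Submodule.span ℂ resSet, a * b ∈ resSpan := by
    intro a ha b hb
    induction ha using Submodule.span_induction with
    | mem x hx =>
      induction hb using Submodule.span_induction with
      | mem y hy =>
        rcases hx with rfl | ⟨z, hz, rfl⟩
        · rw [one_mul]; exact span_le_resSpan (Submodule.subset_span hy)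
        · rcases hy with rfl | ⟨w, hw, rfl⟩
          · rw [mul_one]; exact resF_mem hz
          · exact resF_mul_mem hz hw
      | zero => rw [mul_zero]; exact Submodule.zero_mem _
      | add p q _ _ h1 h2 => rw [mul_add]; exact Submodule.add_mem _ h1 h2
      | smul c p _ h => rw [mul_smul_comm]; exact Submodule.smul_mem _ _ h
    | zero => rw [zero_mul]; exact Submodule.zero_mem _
    | add p q _ _ h1 h2 => rw [add_mul]; exact Submodule.add_mem _ h1 h2
    | smul c p _ h => rw [smul_mul_assoc]; exact Submodule.smul_mem _ _ h
  have hf' : f ∈ closure (Submodule.span ℂ resSet : Set C(OnePoint ℝ, ℂ)) := hf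
  have hg' : g ∈ closure (Submodule.span ℂ resSet : Set C(OnePoint ℝ, ℂ)) := hg
  have := map_mem_closure₂ (u := (resSpan : Set C(OnePoint ℝ, ℂ))) continuous_mul hf' hg' key
  rwa [isClosed_resSpan.closure_eq] at this

lemma resF_star {z : ℂ} (hz : z.im ≠ 0) :
    star (resF z hz) = resF ((starRingEnd ℂ) z) (by simpa using hz) := by
  apply resF_ext
  · simp [resF_infty]
  · intro x
    simp [resF_coe]

lemma resSpan_star {f : C(OnePoint ℝ, ℂ)} (hf : f ∈ resSpan) : star f ∈ resSpan := by
  have key : ∀ a ∈ Submodule.span ℂ resSet, star a ∈ resSpan := by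
    intro a ha
    induction ha using Submodule.span_induction with
    | mem x hx =>
      rcases hx with rfl | ⟨z, hz, rfl⟩
      · rw [star_one]; exact one_mem_resSpan
      · rw [resF_star]; exact resF_mem _
    | zero => rw [star_zero]; exact Submodule.zero_mem _
    | add p q _ _ h1 h2 => rw [star_add]; exact Submodule.add_mem _ h1 h2
    | smul c p _ h => rw [star_smul]; exact Submodule.smul_mem _ _ h
  have hf' : f ∈ closure (Submodule.span ℂ resSet : Set C(OnePoint ℝ, ℂ)) := hf
  have := map_mem_closure (t := (resSpan : Set C(OnePoint ℝ, ℂ))) continuous_star hf' key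
  rwa [isClosed_resSpan.closure_eq] at this

lemma resSpan_top (f : C(OnePoint ℝ, ℂ)) : f ∈ resSpan := by
  let A : StarSubalgebra ℂ C(OnePoint ℝ, ℂ) :=
    { resSpan.toSubalgebra one_mem_resSpan (fun _ _ h1 h2 => resSpan_mul h1 h2) with
      star_mem' := fun h => resSpan_star h }
  have hI : Complex.I.im ≠ 0 := by simp
  have hsep : A.SeparatesPoints := by
    intro x y hxy
    refine ⟨resF Complex.I hI, ⟨resF Complex.I hI, resF_mem hI, rfl⟩, ?_⟩
    intro h
    apply hxy
    induction x using OnePoint.rec with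
    | infty =>
      induction y using OnePoint.rec with
      | infty => rfl
      | coe y =>
        rw [resF_infty, resF_coe] at h
        exact absurd h.symm (inv_ne_zero (sub_ofReal_ne hI y))
    | coe x =>
      induction y using OnePoint.rec with
      | infty =>
        rw [resF_infty, resF_coe] at h
        exact absurd h (inv_ne_zero (sub_ofReal_ne hI x))
      | coe y =>
        rw [resF_coe, resF_coe] at h
        have h2 := inv_injective h
        have h3 : (x : ℂ) = y := by linear_combination -h2
        rw [Complex.ofReal_inj.1 h3]
  have htop := ContinuousMap.starSubalgebra_topologicalClosure_eq_top_of_separatesPoints A hsep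
  have : f ∈ A.topologicalClosure := by rw [htop]; trivial
  have h2 : f ∈ closure (A : Set C(OnePoint ℝ, ℂ)) := this
  have h3 : (A : Set C(OnePoint ℝ, ℂ)) = (resSpan : Set C(OnePoint ℝ, ℂ)) := rfl
  rw [h3, isClosed_resSpan.closure_eq] at h2
  exact h2

lemma integrable_onePoint (f : C(OnePoint ℝ, ℂ)) (τ : Measure ℝ) [IsFiniteMeasure τ] :
    Integrable (fun x : ℝ => f (x : OnePoint ℝ)) τ := by
  have hc : Continuous (fun x : ℝ => f (x : OnePoint ℝ)) := f.continuous.comp OnePoint.continuous_coe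
  exact Integrable.of_bound hc.aestronglyMeasurable ‖f‖
    (Eventually.of_forall fun x => f.norm_coe_le_norm _)

lemma tendsto_onePoint {τ : ℕ → Measure ℝ} [∀ n, IsFiniteMeasure (τ n)] {τ0 : Measure ℝ}
    [IsFiniteMeasure τ0]
    (hmass : Tendsto (fun n => (τ n).real univ) atTop (𝓝 (τ0.real univ)))
    (hG : ∀ z : ℂ, 0 < z.im → z ≠ Complex.I →
      Tendsto (fun n => cauchyTransform (τ n) z) atTop (𝓝 (cauchyTransform τ0 z)))
    (f : C(OnePoint ℝ, ℂ)) :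
    Tendsto (fun n => ∫ x : ℝ, f (x : OnePoint ℝ) ∂(τ n)) atTop
      (𝓝 (∫ x : ℝ, f (x : OnePoint ℝ) ∂τ0)) := by
  let V : Submodule ℂ C(OnePoint ℝ, ℂ) :=
    { carrier := {f | Tendsto (fun n => ∫ x : ℝ, f (x : OnePoint ℝ) ∂(τ n)) atTop
        (𝓝 (∫ x : ℝ, f (x : OnePoint ℝ) ∂τ0))}
      add_mem' := by
        intro f g hf hg
        simp only [mem_ofPred_eq, ContinuousMap.add_apply] at *
        have := hf.add hg
        rw [← integral_add (integrable_onePoint f _) (integrable_onePoint g _)] at this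
        refine this.congr (fun n => ?_)
        rw [integral_add (integrable_onePoint f _) (integrable_onePoint g _)]
      zero_mem' := by simp
      smul_mem' := by
        intro c f hf
        simp only [mem_ofPred_eq, ContinuousMap.smul_apply] at *
        simp_rw [integral_smul]
        exact hf.const_smul c }
  have hVc : IsClosed (V : Set C(OnePoint ℝ, ℂ)) := by
    rw [← closure_subset_iff_isClosed]
    intro f hf
    change Tendsto _ _ _
    rw [Metric.tendsto_nhds]
    intro ε hε
    set M := τ0.real univ + 1 with hM
    have hMp : 0 < M := by positivity
    obtain ⟨g, hg, hfg⟩ := Metric.mem_closure_iff.1 hf (ε / (4 * M)) (by positivity)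
    have hg' : Tendsto (fun n => ∫ x : ℝ, g (x : OnePoint ℝ) ∂(τ n)) atTop
        (𝓝 (∫ x : ℝ, g (x : OnePoint ℝ) ∂τ0)) := hg
    have hbd : ∀ t : Measure ℝ, IsFiniteMeasure t → t.real univ ≤ M →
        ‖(∫ x : ℝ, f (x : OnePoint ℝ) ∂t) - ∫ x : ℝ, g (x : OnePoint ℝ) ∂t‖ ≤ ε / 4 := by
      intro t ht htm
      rw [← integral_sub (integrable_onePoint f _) (integrable_onePoint g _)]
      refine (norm_integral_le_of_norm_le_const (C := ε / (4 * M))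
        (Eventually.of_forall fun x => ?_)).trans ?_
      · have := (f - g).norm_coe_le_norm (x : OnePoint ℝ)
        rw [ContinuousMap.sub_apply] at this
        rw [dist_eq_norm] at hfg
        exact this.trans hfg.le
      · calc _ ≤ ε / (4 * M) * M := by gcongr
          _ = ε / 4 := by field_simp
    filter_upwards [Metric.tendsto_nhds.1 hg' (ε/4) (by positivity),
      hmass.eventually_lt_const (show τ0.real univ < M by simp [hM])] with n h1 h2
    have b1 := hbd (τ n) inferInstance h2.le
    have b2 := hbd τ0 inferInstance (by simp [hM])
    rw [dist_eq_norm] at h1 ⊢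
    set a := ∫ x : ℝ, f (x : OnePoint ℝ) ∂(τ n)
    set b := ∫ x : ℝ, f (x : OnePoint ℝ) ∂τ0
    set c := ∫ x : ℝ, g (x : OnePoint ℝ) ∂(τ n)
    set d := ∫ x : ℝ, g (x : OnePoint ℝ) ∂τ0
    have : a - b = (a - c) + (c - d) - (b - d) := by ring
    rw [this]
    have := norm_sub_le ((a - c) + (c - d)) (b - d)
    have := norm_add_le (a - c) (c - d)
    linarith
  have hres1 : ∀ (z : ℂ) (hz : z.im ≠ 0), 0 < z.im → z ≠ Complex.I → resF z hz ∈ V := by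
    intro z hz hp hne
    exact hG z hp hne
  have hres2 : ∀ (z : ℂ) (hz : z.im ≠ 0), 0 < z.im → resF z hz ∈ V := by
    intro z hz hp
    by_cases hne : z = Complex.I
    · refine hVc.mem_of_tendsto (resF_tendsto hz) (Eventually.of_forall fun m => ?_)
      apply hres1
      · simpa using hp
      · rw [hne]
        intro h
        have h2 : (((1 / ((m:ℝ) + 1) : ℝ) : ℂ)) = 0 := by linear_combination h
        rw [Complex.ofReal_eq_zero] at h2
        have : (0:ℝ) < 1 / ((m:ℝ) + 1) := by positivity
        linarith
    · exact hres1 z hz hp hne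
  have hres3 : ∀ (z : ℂ) (hz : z.im ≠ 0), resF z hz ∈ V := by
    intro z hz
    rcases lt_or_gt_of_ne hz with h | h
    · have h1 : 0 < ((starRingEnd ℂ) z).im := by simpa using h
      have h2 := hres2 _ h1.ne' h1
      have h3 : Tendsto (fun n => ∫ x : ℝ, resF _ h1.ne' (x : OnePoint ℝ) ∂(τ n)) atTop
        (𝓝 (∫ x : ℝ, resF _ h1.ne' (x : OnePoint ℝ) ∂τ0)) := h2
      have h4 := (Complex.continuous_conj.tendsto _).comp h3
      change Tendsto _ _ _
      rw [← integral_conj] at h4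
      have e : ∀ x : ℝ, (starRingEnd ℂ) (resF _ h1.ne' (x : OnePoint ℝ)) = resF z hz (x : OnePoint ℝ) := by
        intro x; simp [resF_coe]
      simp only [e] at h4
      refine h4.congr (fun n => ?_)
      simp only [Function.comp]
      rw [← integral_conj]
      simp only [e]
    · exact hres2 z hz h
  have hone : (1 : C(OnePoint ℝ, ℂ)) ∈ V := by
    change Tendsto _ _ _
    have := (Complex.continuous_ofReal.tendsto _).comp hmass
    simpa [Function.comp_def] using this
  have hle : resSpan ≤ V := by
    apply Submodule.topologicalClosure_minimal _ _ hVc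
    rw [Submodule.span_le]
    rintro _ (rfl | ⟨z, hz, rfl⟩)
    · exact hone
    · exact hres3 z hz
  exact hle (resSpan_top f)

lemma cutoff_tendsto (τ0 : Measure ℝ) [IsFiniteMeasure τ0] :
    Tendsto (fun m : ℕ => ∫ x : ℝ, (1 + x^2 / ((m:ℝ) + 1))⁻¹ ∂τ0) atTop (𝓝 (τ0.real univ)) := by
  have h1 : τ0.real univ = ∫ _x : ℝ, (1:ℝ) ∂τ0 := by simp
  rw [h1]
  apply tendsto_integral_of_dominated_convergence (fun _ => (1:ℝ))
  · intro m
    apply Continuous.aestronglyMeasurable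
    apply Continuous.inv₀ (by fun_prop)
    intro x; positivity
  · simp
  · intro m
    refine Eventually.of_forall fun x => ?_
    rw [Real.norm_eq_abs, abs_of_pos (by positivity)]
    apply inv_le_one_of_one_le₀
    have : 0 ≤ x^2 / ((m:ℝ)+1) := by positivity
    linarith
  · refine Eventually.of_forall fun x => ?_
    have h := (tendsto_one_div_add_atTop_nhds_zero_nat (𝕜 := ℝ)).const_mul (x^2)
    have h2 := (h.const_add 1).inv₀ (by simp)
    simp only [mul_zero, add_zero, inv_one] at h2
    refine h2.congr (fun m => ?_)
    rw [mul_one_div]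

lemma tendsto_cutoff_cocompact (m : ℕ) :
    Tendsto (fun x : ℝ => (1 + x^2 / ((m:ℝ) + 1))⁻¹) (cocompact ℝ) (𝓝 0) := by
  apply tendsto_inv_atTop_zero.comp
  apply tendsto_atTop_add_const_left
  apply Tendsto.atTop_div_const (by positivity)
  have := (tendsto_pow_atTop (α := ℝ) (n := 2) (by norm_num)).comp (tendsto_norm_cocompact_atTop (E := ℝ))
  refine this.congr (fun x => ?_)
  simp

lemma weakLim_of_cauchy {τ : ℕ → Measure ℝ} [∀ n, IsFiniteMeasure (τ n)] {τ0 : Measure ℝ}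
    [IsFiniteMeasure τ0]
    (hmass : Tendsto (fun n => (τ n).real univ) atTop (𝓝 (τ0.real univ)))
    (hG : ∀ z : ℂ, 0 < z.im → z ≠ Complex.I →
      Tendsto (fun n => cauchyTransform (τ n) z) atTop (𝓝 (cauchyTransform τ0 z))) :
    WeakLim τ τ0 := by
  intro g
  have hχc : ∀ m : ℕ, Continuous (fun x : ℝ => (1 + x^2 / ((m:ℝ) + 1))⁻¹) := by
    intro m
    apply Continuous.inv₀ (by fun_prop)
    intro x; positivity
  have hχ0 : ∀ (m : ℕ) (x : ℝ), 0 < (1 + x^2 / ((m:ℝ) + 1))⁻¹ := by intro m x; positivity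
  have hχ1 : ∀ (m : ℕ) (x : ℝ), (1 + x^2 / ((m:ℝ) + 1))⁻¹ ≤ 1 := by
    intro m x
    apply inv_le_one_of_one_le₀
    have : 0 ≤ x^2 / ((m:ℝ)+1) := by positivity
    linarith
  -- convergence for functions vanishing at infinity
  have hC0 : ∀ h : ℝ → ℝ, Continuous h → Tendsto h (cocompact ℝ) (𝓝 0) →
      Tendsto (fun n => ∫ x, h x ∂(τ n)) atTop (𝓝 (∫ x, h x ∂τ0)) := by
    intro h hc h0
    let f : C(OnePoint ℝ, ℂ) := OnePoint.continuousMapMk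
      ⟨fun x : ℝ => (h x : ℂ), Complex.continuous_ofReal.comp hc⟩ 0 (by
        rw [coclosedCompact_eq_cocompact]
        have := (Complex.continuous_ofReal.tendsto _).comp h0
        rw [Complex.ofReal_zero] at this
        exact this)
    have hf : ∀ x : ℝ, f (x : OnePoint ℝ) = (h x : ℂ) := fun x => rfl
    have := tendsto_onePoint hmass hG f
    simp only [hf, integral_complex_ofReal] at this
    have := (Complex.continuous_re.tendsto _).comp this
    simpa [Function.comp_def] using this
  set B := ‖g‖ + 1 with hB
  have hBp : 0 < B := by positivity
  have hgB : ∀ x, |g x| ≤ B := fun x => (g.norm_coe_le_norm x).trans (by simp [hB])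
  have hInt : ∀ (t : Measure ℝ) [IsFiniteMeasure t] (m : ℕ),
      |(∫ x, g x ∂t) - ∫ x, g x * (1 + x^2 / ((m:ℝ) + 1))⁻¹ ∂t| ≤
        B * (t.real univ - ∫ x, (1 + x^2 / ((m:ℝ) + 1))⁻¹ ∂t) := by
    intro t _ m
    have i1 : Integrable (fun x => g x) t := g.integrable t
    have i3 : Integrable (fun x : ℝ => (1 + x^2 / ((m:ℝ) + 1))⁻¹) t := by
      apply Integrable.of_bound (hχc m).aestronglyMeasurable 1
      refine Eventually.of_forall fun x => ?_
      rw [Real.norm_eq_abs, abs_of_pos (hχ0 m x)]; exact hχ1 m x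
    have i2 : Integrable (fun x : ℝ => g x * (1 + x^2 / ((m:ℝ) + 1))⁻¹) t := by
      apply Integrable.of_bound (g.continuous.mul (hχc m)).aestronglyMeasurable B
      refine Eventually.of_forall fun x => ?_
      change ‖g x * (1 + x^2 / ((m:ℝ) + 1))⁻¹‖ ≤ B
      rw [norm_mul, Real.norm_eq_abs, Real.norm_eq_abs, abs_of_pos (hχ0 m x)]
      nlinarith [hgB x, hχ1 m x, hχ0 m x, abs_nonneg (g x)]
    have i4 : t.real univ = ∫ _x : ℝ, (1:ℝ) ∂t := by simp
    rw [← integral_sub i1 i2, i4, ← integral_sub (integrable_const _) i3, ← integral_const_mul]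
    rw [← Real.norm_eq_abs]
    apply norm_integral_le_of_norm_le (((integrable_const _).sub i3).const_mul B)
    refine Eventually.of_forall fun x => ?_
    rw [Real.norm_eq_abs]
    have : g x - g x * (1 + x^2 / ((m:ℝ) + 1))⁻¹ = g x * (1 - (1 + x^2 / ((m:ℝ) + 1))⁻¹) := by ring
    rw [this, abs_mul, abs_of_nonneg (show 0 ≤ 1 - (1 + x^2 / ((m:ℝ) + 1))⁻¹ by linarith [hχ1 m x])]
    have := hχ1 m x
    change _ ≤ B * (1 - (1 + x^2 / ((m:ℝ) + 1))⁻¹)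
    exact mul_le_mul_of_nonneg_right (hgB x) (by linarith)
  rw [Metric.tendsto_nhds]
  intro ε hε
  have hcut := (cutoff_tendsto τ0).eventually_const_lt
    (show τ0.real univ - ε / (8 * B) < τ0.real univ by
      have : 0 < ε / (8 * B) := by positivity
      linarith)
  obtain ⟨m, hm⟩ := hcut.exists
  have l1 := hC0 _ (hχc m) (tendsto_cutoff_cocompact m)
  have l2 := hC0 (fun x => g x * (1 + x^2 / ((m:ℝ) + 1))⁻¹) (g.continuous.mul (hχc m)) (by
    have := (tendsto_cutoff_cocompact m).const_mul B
    rw [mul_zero] at this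
    refine squeeze_zero_norm (fun x => ?_) this
    rw [norm_mul, Real.norm_eq_abs, Real.norm_eq_abs, abs_of_pos (hχ0 m x)]
    exact mul_le_mul_of_nonneg_right (hgB x) (hχ0 m x).le)
  have l3 := (hmass.sub l1).eventually_lt_const (u := ε / (4 * B)) (by
    have : ε / (4 * B) = 2 * (ε / (8 * B)) := by field_simp; ring
    have h8 : 0 < ε / (8 * B) := by positivity
    linarith)
  filter_upwards [l3, Metric.tendsto_nhds.1 l2 (ε/4) (by positivity)] with n h1 h2
  have b1 := hInt (τ n) m
  have b2 := hInt τ0 m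
  have c1 : B * ((τ n).real univ - ∫ x, (1 + x^2 / ((m:ℝ) + 1))⁻¹ ∂(τ n)) ≤ ε / 4 := by
    calc _ ≤ B * (ε / (4 * B)) := by gcongr
      _ = ε / 4 := by field_simp
  have c2 : B * (τ0.real univ - ∫ x, (1 + x^2 / ((m:ℝ) + 1))⁻¹ ∂τ0) ≤ ε / 8 := by
    calc _ ≤ B * (ε / (8 * B)) := by gcongr; linarith
      _ = ε / 8 := by field_simp
  rw [Real.dist_eq] at h2 ⊢
  have d1 := abs_le.1 (b1.trans c1)
  have d2 := abs_le.1 (b2.trans c2)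
  have d3 := abs_lt.1 h2
  rw [abs_lt]
  constructor <;> linarith [d1.1, d1.2, d2.1, d2.2, d3.1, d3.2]

lemma weakLim_complex {τ : ℕ → Measure ℝ} [∀ n, IsFiniteMeasure (τ n)] {τ0 : Measure ℝ}
    [IsFiniteMeasure τ0] (h : WeakLim τ τ0) {f : ℝ → ℂ} (hc : Continuous f) {C : ℝ}
    (hb : ∀ x, ‖f x‖ ≤ C) :
    Tendsto (fun n => ∫ x, f x ∂(τ n)) atTop (𝓝 (∫ x, f x ∂τ0)) := by
  have hre := h (BoundedContinuousFunction.ofNormedAddCommGroup (fun x => (f x).re)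
    (Complex.continuous_re.comp hc) C (fun x => (Complex.abs_re_le_norm _).trans (hb x)))
  have him := h (BoundedContinuousFunction.ofNormedAddCommGroup (fun x => (f x).im)
    (Complex.continuous_im.comp hc) C (fun x => (Complex.abs_im_le_norm _).trans (hb x)))
  simp only [BoundedContinuousFunction.coe_ofNormedAddCommGroup] at hre him
  have hInt : ∀ (t : Measure ℝ) [IsFiniteMeasure t], Integrable f t := fun t _ =>
    Integrable.of_bound hc.aestronglyMeasurable C (Eventually.of_forall hb)
  have heq : ∀ (t : Measure ℝ) [IsFiniteMeasure t],
      ((∫ x, (f x).re ∂t : ℝ) : ℂ) + ((∫ x, (f x).im ∂t : ℝ) : ℂ) * Complex.I = ∫ x, f x ∂t := by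
    intro t _
    exact integral_re_add_im (hInt t)
  have := ((Complex.continuous_ofReal.tendsto _).comp hre).add
    (((Complex.continuous_ofReal.tendsto _).comp him).mul_const Complex.I)
  rw [heq] at this
  refine this.congr (fun n => ?_)
  exact heq _

lemma integrable_res {z : ℂ} (hz : z.im ≠ 0) (τ : Measure ℝ) [IsFiniteMeasure τ] :
    Integrable (fun x : ℝ => (z - (x : ℂ))⁻¹) τ :=
  Integrable.of_bound (continuous_res hz).aestronglyMeasurable _
    (Eventually.of_forall (norm_res_le hz))

lemma tendsto_cauchy {τ : ℕ → Measure ℝ} [∀ n, IsFiniteMeasure (τ n)] {τ0 : Measure ℝ}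
    [IsFiniteMeasure τ0] (h : WeakLim τ τ0) {z : ℂ} (hz : z.im ≠ 0) :
    Tendsto (fun n => cauchyTransform (τ n) z) atTop (𝓝 (cauchyTransform τ0 z)) :=
  weakLim_complex h (continuous_res hz) (norm_res_le hz)

lemma tendsto_mass {τ : ℕ → Measure ℝ} [∀ n, IsFiniteMeasure (τ n)] {τ0 : Measure ℝ}
    [IsFiniteMeasure τ0] (h : WeakLim τ τ0) :
    Tendsto (fun n => (τ n).real univ) atTop (𝓝 (τ0.real univ)) := by
  have := h (BoundedContinuousFunction.const ℝ 1)
  simpa using this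

lemma diff_cauchy (τ : Measure ℝ) [IsFiniteMeasure τ] :
    DifferentiableOn ℂ (cauchyTransform τ) UHP := by
  have h : ∀ z, cauchyTransform τ z = - resolventTransform τ z := by
    intro z
    rw [resolventTransform_apply, cauchyTransform, ← integral_neg]
    congr 1
    ext x
    rw [resolvent, Ring.inverse_eq_inv', ← inv_neg]
    simp
  intro z hz
  have hz' : 0 < z.im := hz
  have hnot : z ∉ algebraMap ℝ ℂ '' τ.support := by
    rintro ⟨x, _, rfl⟩
    simp at hz'
  have := (hasDerivAt_resolventTransform (μ := τ) z hnot).neg.differentiableAt.differentiableWithinAt (s := UHP)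
  exact this.congr (fun y _ => h y) (h z)

lemma res_im (z : ℂ) (x : ℝ) : ((z - (x : ℂ))⁻¹).im = - z.im * ‖(z - (x : ℂ))⁻¹‖ ^ 2 := by
  rw [Complex.inv_im, norm_inv, Complex.normSq_eq_norm_sq]
  simp
  ring

lemma cauchy_im {z : ℂ} (hz : z.im ≠ 0) (τ : Measure ℝ) [IsFiniteMeasure τ] :
    (cauchyTransform τ z).im = - z.im * ∫ x : ℝ, ‖(z - (x : ℂ))⁻¹‖ ^ 2 ∂τ := by
  have := Complex.imCLM.integral_comp_comm (integrable_res hz τ)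
  simp only [Complex.imCLM_apply, res_im] at this
  rw [cauchyTransform, ← this, integral_const_mul]

lemma integrable_res_norm {z : ℂ} (hz : z.im ≠ 0) (τ : Measure ℝ) [IsFiniteMeasure τ] (p : ℕ) :
    Integrable (fun x : ℝ => ‖(z - (x : ℂ))⁻¹‖ ^ p) τ := by
  apply Integrable.of_bound ((continuous_res hz).norm.pow p).aestronglyMeasurable (|z.im|⁻¹ ^ p)
  refine Eventually.of_forall fun x => ?_
  change ‖‖(z - (x : ℂ))⁻¹‖ ^ p‖ ≤ _
  rw [norm_pow, norm_norm]
  gcongr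
  exact norm_res_le hz x

lemma cauchy_norm_sq {z : ℂ} (hz : z.im ≠ 0) (τ : Measure ℝ) [IsProbabilityMeasure τ] :
    ‖cauchyTransform τ z‖ ^ 2 ≤ ∫ x : ℝ, ‖(z - (x : ℂ))⁻¹‖ ^ 2 ∂τ := by
  set m := ∫ x : ℝ, ‖(z - (x : ℂ))⁻¹‖ ∂τ with hm
  have h1 : ‖cauchyTransform τ z‖ ≤ m := norm_integral_le_integral_norm _
  have i1 : Integrable (fun x : ℝ => ‖(z - (x : ℂ))⁻¹‖) τ := (integrable_res hz τ).norm
  have i2 := integrable_res_norm hz τ 2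
  have h2 : 0 ≤ ∫ x : ℝ, (‖(z - (x : ℂ))⁻¹‖ - m) ^ 2 ∂τ := integral_nonneg fun x => sq_nonneg _
  have h3 : ∫ x : ℝ, (‖(z - (x : ℂ))⁻¹‖ - m) ^ 2 ∂τ =
      (∫ x : ℝ, ‖(z - (x : ℂ))⁻¹‖ ^ 2 ∂τ) - m ^ 2 := by
    have : ∀ x : ℝ, (‖(z - (x : ℂ))⁻¹‖ - m) ^ 2 =
        ‖(z - (x : ℂ))⁻¹‖ ^ 2 - (2 * m) * ‖(z - (x : ℂ))⁻¹‖ + m ^ 2 := by intro x; ring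
    simp only [this]
    have i3 : Integrable (fun x : ℝ => ‖(z - (x : ℂ))⁻¹‖ ^ 2 - (2 * m) * ‖(z - (x : ℂ))⁻¹‖) τ :=
      i2.sub (i1.const_mul _)
    rw [integral_add i3 (integrable_const _),
      integral_sub i2 (i1.const_mul _), integral_const_mul, ← hm]
    simp
    ring
  have h4 : ‖cauchyTransform τ z‖ ^ 2 ≤ m ^ 2 := by gcongr
  linarith

lemma cauchy_im_neg {z : ℂ} (hz : z ∈ UHP) (τ : Measure ℝ) [IsProbabilityMeasure τ] :
    (cauchyTransform τ z).im < 0 := by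
  have hz' : 0 < z.im := hz
  rw [cauchy_im hz'.ne']
  have : 0 < ∫ x : ℝ, ‖(z - (x : ℂ))⁻¹‖ ^ 2 ∂τ := by
    rw [integral_pos_iff_support_of_nonneg (fun x => by positivity) (integrable_res_norm hz'.ne' τ 2)]
    have : Function.support (fun x : ℝ => ‖(z - (x : ℂ))⁻¹‖ ^ 2) = univ := by
      ext x
      have := sub_ofReal_ne hz'.ne' x
      simp [this]
    rw [this]; simp
  nlinarith

lemma cauchy_ne {z : ℂ} (hz : z ∈ UHP) (τ : Measure ℝ) [IsProbabilityMeasure τ] :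
    cauchyTransform τ z ≠ 0 := by
  intro h
  have := cauchy_im_neg hz τ
  rw [h] at this
  simp at this

lemma diff_F (τ : Measure ℝ) [IsProbabilityMeasure τ] :
    DifferentiableOn ℂ (Ftransform τ) UHP :=
  (diff_cauchy τ).inv (fun _ hz => cauchy_ne hz τ)

lemma F_im {z : ℂ} (hz : z ∈ UHP) (τ : Measure ℝ) [IsProbabilityMeasure τ] :
    z.im ≤ (Ftransform τ z).im := by
  have hz' : 0 < z.im := hz
  have h1 := cauchy_norm_sq hz'.ne' τ
  have h2 := cauchy_im hz'.ne' τ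
  have h3 : 0 < ‖cauchyTransform τ z‖ := norm_pos_iff.2 (cauchy_ne hz τ)
  rw [Ftransform, Complex.inv_im, h2, Complex.normSq_eq_norm_sq, le_div_iff₀ (by positivity)]
  nlinarith

/-- The Nevanlinna-type integral, in closed form. -/
noncomputable def phiT (τ : Measure ℝ) (z : ℂ) : ℂ :=
  (1 + z ^ 2) * cauchyTransform τ z - z * (τ.real univ : ℂ)

lemma phi_ptw {z : ℂ} (hz : z.im ≠ 0) (x : ℝ) :
    (1 + (x : ℂ) * z) / (z - (x : ℂ)) = (1 + z ^ 2) * (z - (x : ℂ))⁻¹ - z := by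
  have := sub_ofReal_ne hz x
  field_simp
  ring

lemma phi_eq {z : ℂ} (hz : z.im ≠ 0) (τ : Measure ℝ) [IsFiniteMeasure τ] :
    ∫ x : ℝ, (1 + (x : ℂ) * z) / (z - (x : ℂ)) ∂τ = phiT τ z := by
  simp only [phi_ptw hz]
  rw [integral_sub ((integrable_res hz τ).const_mul _) (integrable_const _), integral_const_mul]
  simp [phiT, cauchyTransform, mul_comm]

lemma phi_diff (τ : Measure ℝ) [IsFiniteMeasure τ] : DifferentiableOn ℂ (phiT τ) UHP := by
  have := diff_cauchy τ
  unfold phiT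
  fun_prop

lemma phi_im {z : ℂ} (hz : z ∈ UHP) (τ : Measure ℝ) [IsFiniteMeasure τ] : (phiT τ z).im ≤ 0 := by
  have hz' : 0 < z.im := hz
  have hInt : Integrable (fun x : ℝ => (1 + (x : ℂ) * z) / (z - (x : ℂ))) τ := by
    simp only [phi_ptw hz'.ne']
    exact ((integrable_res hz'.ne' τ).const_mul _).sub (integrable_const _)
  have := Complex.imCLM.integral_comp_comm hInt
  simp only [Complex.imCLM_apply] at this
  rw [← phi_eq hz'.ne', ← this]
  apply integral_nonpos
  intro x
  change ((1 + (x : ℂ) * z) / (z - (x : ℂ))).im ≤ 0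
  have h0 := sub_ofReal_ne hz'.ne' x
  have hn : 0 < Complex.normSq (z - x) := Complex.normSq_pos.2 h0
  rw [Complex.div_im, ← sub_div]
  apply div_nonpos_of_nonpos_of_nonneg _ hn.le
  simp
  nlinarith [mul_nonneg hz'.le (sq_nonneg x)]

lemma phi_I (τ : Measure ℝ) : phiT τ Complex.I = - Complex.I * (τ.real univ : ℂ) := by
  simp [phiT]

/-- Tail functional. -/
noncomputable def tailJ (τ : Measure ℝ) (y : ℝ) : ℝ := ∫ x : ℝ, |x| / √(x ^ 2 + y ^ 2) ∂τ

lemma tail_cont {y : ℝ} (hy : 0 < y) : Continuous (fun x : ℝ => |x| / √(x ^ 2 + y ^ 2)) := by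
  apply Continuous.div (by fun_prop) (by fun_prop)
  intro x; positivity

lemma tail_le_one {y : ℝ} (hy : 0 < y) (x : ℝ) : |x| / √(x ^ 2 + y ^ 2) ≤ 1 := by
  rw [div_le_one (by positivity)]
  apply Real.abs_le_sqrt
  nlinarith

lemma tail_integrable {y : ℝ} (hy : 0 < y) (τ : Measure ℝ) [IsFiniteMeasure τ] :
    Integrable (fun x : ℝ => |x| / √(x ^ 2 + y ^ 2)) τ := by
  apply Integrable.of_bound (tail_cont hy).aestronglyMeasurable 1
  refine Eventually.of_forall fun x => ?_
  rw [Real.norm_eq_abs, abs_of_nonneg (by positivity)]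
  exact tail_le_one hy x

lemma tail_anti {y y' : ℝ} (hy : 0 < y) (hyy : y ≤ y') (τ : Measure ℝ) [IsFiniteMeasure τ] :
    tailJ τ y' ≤ tailJ τ y := by
  apply integral_mono (tail_integrable (hy.trans_le hyy) τ) (tail_integrable hy τ)
  intro x
  change |x| / √(x ^ 2 + y' ^ 2) ≤ |x| / √(x ^ 2 + y ^ 2)
  gcongr

lemma tail_tendsto (τ : Measure ℝ) [IsFiniteMeasure τ] : Tendsto (tailJ τ) atTop (𝓝 0) := by
  have : Tendsto (tailJ τ) atTop (𝓝 (∫ _x : ℝ, (0:ℝ) ∂τ)) := by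
    apply tendsto_integral_filter_of_dominated_convergence (fun _ => (1:ℝ))
    · filter_upwards [eventually_gt_atTop 0] with y hy using (tail_cont hy).aestronglyMeasurable
    · filter_upwards [eventually_gt_atTop 0] with y hy
      refine Eventually.of_forall fun x => ?_
      rw [Real.norm_eq_abs, abs_of_nonneg (by positivity)]
      exact tail_le_one hy x
    · simp
    · refine Eventually.of_forall fun x => ?_
      have h : Tendsto (fun y : ℝ => |x| / y) atTop (𝓝 0) := tendsto_const_nhds.div_atTop tendsto_id
      refine squeeze_zero' (Eventually.of_forall fun y => by positivity) ?_ h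
      filter_upwards [eventually_gt_atTop 0] with y hy
      gcongr
      apply Real.le_sqrt_of_sq_le
      nlinarith
  simpa using this

lemma tail_weak {τ : ℕ → Measure ℝ} {τ0 : Measure ℝ} (h : WeakLim τ τ0) {y : ℝ} (hy : 0 < y) :
    Tendsto (fun n => tailJ (τ n) y) atTop (𝓝 (tailJ τ0 y)) :=
  h (BoundedContinuousFunction.ofNormedAddCommGroup (fun x : ℝ => |x| / √(x ^ 2 + y ^ 2))
    (tail_cont hy) 1 (fun x => by
      rw [Real.norm_eq_abs, abs_of_nonneg (by positivity)]
      exact tail_le_one hy x))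

lemma iy_im (y : ℝ) : ((y : ℂ) * Complex.I).im = y := by simp

lemma tail_bound {y : ℝ} (hy : 0 < y) (τ : Measure ℝ) [IsFiniteMeasure τ] :
    ‖(y * Complex.I) * cauchyTransform τ (y * Complex.I) - (τ.real univ : ℂ)‖ ≤ tailJ τ y := by
  set z : ℂ := y * Complex.I with hz
  have hzim : z.im ≠ 0 := by rw [hz, iy_im]; exact hy.ne'
  have h1 : z * cauchyTransform τ z - (τ.real univ : ℂ) = ∫ x : ℝ, (z * (z - (x:ℂ))⁻¹ - 1) ∂τ := by
    rw [integral_sub ((integrable_res hzim τ).const_mul _) (integrable_const _), integral_const_mul]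
    simp [cauchyTransform]
  rw [h1]
  apply norm_integral_le_of_norm_le (tail_integrable hy τ)
  refine Eventually.of_forall fun x => ?_
  have h0 := sub_ofReal_ne hzim x
  have h2 : z * (z - (x:ℂ))⁻¹ - 1 = x / (z - x) := by field_simp; ring
  rw [h2, norm_div, Complex.norm_real, Real.norm_eq_abs]
  apply le_of_eq
  congr 1
  rw [Complex.norm_def, Complex.normSq_apply, hz]
  simp
  ring_nf

lemma F_tail {y ε : ℝ} (hy : 0 < y) (τ : Measure ℝ) [IsProbabilityMeasure τ] (hε : ε ≤ 1 / 2)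
    (h : tailJ τ y ≤ ε) :
    ‖Ftransform τ (y * Complex.I) - y * Complex.I‖ ≤ 2 * ε * y := by
  have hb := (tail_bound hy τ).trans h
  set z : ℂ := y * Complex.I with hz
  have hzU : z ∈ UHP := by change 0 < z.im; rw [hz, iy_im]; exact hy
  have hG := cauchy_ne hzU τ
  have hz0 : z ≠ 0 := by rintro h0; rw [h0] at hzU; exact lt_irrefl (0:ℝ) hzU
  simp only [probReal_univ, Complex.ofReal_one] at hb
  set r := z * cauchyTransform τ z - 1 with hr
  have hr1 : 1 / 2 ≤ ‖z * cauchyTransform τ z‖ := by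
    have h1 : z * cauchyTransform τ z = 1 + r := by rw [hr]; ring
    rw [h1]
    have := norm_sub_norm_le (1:ℂ) (-r)
    rw [norm_neg, norm_one, sub_neg_eq_add] at this
    linarith
  have h2 : Ftransform τ z - z = - (r * z) / (z * cauchyTransform τ z) := by
    rw [Ftransform, hr]; field_simp; ring
  have hzn : ‖z‖ = y := by rw [hz]; simp [abs_of_pos hy]
  rw [h2, norm_div, norm_neg, norm_mul, hzn, div_le_iff₀ (by linarith)]
  have h0 : 0 ≤ ‖r‖ := norm_nonneg _
  nlinarith [mul_nonneg (h0.trans hb) hy.le, mul_le_mul_of_nonneg_right hb hy.le]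

lemma F_growth (τ : Measure ℝ) [IsProbabilityMeasure τ] :
    Tendsto (fun y : ℝ => ‖Ftransform τ (y * Complex.I) - y * Complex.I‖ / y) atTop (𝓝 0) := by
  have h := (tail_tendsto τ).const_mul 2
  rw [mul_zero] at h
  refine squeeze_zero' ?_ ?_ h
  · filter_upwards [eventually_gt_atTop 0] with y hy; positivity
  · filter_upwards [eventually_gt_atTop 0, (tail_tendsto τ).eventually_lt_const
      (show (0:ℝ) < 1/2 by norm_num)] with y hy h2
    rw [div_le_iff₀ hy]
    exact F_tail hy τ h2.le le_rfl

lemma phi_growth (τ : Measure ℝ) [IsFiniteMeasure τ] :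
    Tendsto (fun y : ℝ => ‖phiT τ (y * Complex.I)‖ / y) atTop (𝓝 0) := by
  have h1 : Tendsto (fun y : ℝ => τ.real univ * (y⁻¹ * y⁻¹) + tailJ τ y) atTop (𝓝 0) := by
    have := ((tendsto_inv_atTop_zero (𝕜 := ℝ)).mul tendsto_inv_atTop_zero).const_mul (τ.real univ)
    have := this.add (tail_tendsto τ)
    simpa using this
  refine squeeze_zero' ?_ ?_ h1
  · filter_upwards [eventually_gt_atTop 0] with y hy; positivity
  · filter_upwards [eventually_gt_atTop 0] with y hy
    have hb := tail_bound hy τ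
    set z : ℂ := y * Complex.I with hz
    have hzim : z.im = y := by rw [hz, iy_im]
    have hzn : ‖z‖ = y := by rw [hz]; simp [abs_of_pos hy]
    have hG : ‖cauchyTransform τ z‖ ≤ y⁻¹ * τ.real univ := by
      refine (norm_integral_le_of_norm_le_const (C := y⁻¹) (Eventually.of_forall fun x => ?_)).trans le_rfl
      have := norm_res_le (z := z) (by rw [hzim]; exact hy.ne') x
      rwa [hzim, abs_of_pos hy] at this
    have he : phiT τ z = cauchyTransform τ z + z * (z * cauchyTransform τ z - (τ.real univ : ℂ)) := by
      rw [phiT]; ring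
    rw [he, div_le_iff₀ hy]
    refine (norm_add_le _ _).trans ?_
    rw [norm_mul, hzn]
    have : (τ.real univ * (y⁻¹ * y⁻¹) + tailJ τ y) * y = y⁻¹ * τ.real univ + y * tailJ τ y := by
      field_simp
    rw [this]
    gcongr

/-- The measure with density `K x^2/(1+x^2)`. -/
noncomputable def dens (μ : Measure ℝ) (K : ℕ) : Measure ℝ :=
  μ.withDensity (fun x => ENNReal.ofReal ((K : ℝ) * x^2 / (1 + x^2)))

lemma dens_cont (K : ℕ) : Continuous (fun x : ℝ => (K : ℝ) * x^2 / (1 + x^2)) := by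
  apply Continuous.div (by fun_prop) (by fun_prop)
  intro x; positivity

lemma dens_le (K : ℕ) (x : ℝ) : (K : ℝ) * x^2 / (1 + x^2) ≤ K := by
  rw [div_le_iff₀ (by positivity)]
  have : (0:ℝ) ≤ K := by positivity
  nlinarith

lemma dens_integrable (μ : Measure ℝ) [IsFiniteMeasure μ] (K : ℕ) :
    Integrable (fun x : ℝ => (K : ℝ) * x^2 / (1 + x^2)) μ := by
  apply Integrable.of_bound (dens_cont K).aestronglyMeasurable K
  refine Eventually.of_forall fun x => ?_
  rw [Real.norm_eq_abs, abs_of_nonneg (by positivity)]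
  exact dens_le K x

instance dens_finite (μ : Measure ℝ) [IsFiniteMeasure μ] (K : ℕ) : IsFiniteMeasure (dens μ K) :=
  isFiniteMeasure_withDensity_ofReal (dens_integrable μ K).2

lemma dens_integral (μ : Measure ℝ) (K : ℕ) (f : ℝ → ℂ) :
    ∫ x, f x ∂(dens μ K) = ∫ x, (((K : ℝ) * x^2 / (1 + x^2) : ℝ) : ℂ) * f x ∂μ := by
  rw [dens, integral_withDensity_eq_integral_toReal_smul]
  · congr 1
    ext x
    rw [ENNReal.toReal_ofReal (by positivity), Complex.real_smul]
  · exact (dens_cont K).measurable.ennreal_ofReal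
  · exact Eventually.of_forall fun x => ENNReal.ofReal_lt_top

lemma key_identity (μ : Measure ℝ) [IsProbabilityMeasure μ] (K : ℕ) {z : ℂ} (hz : z ∈ UHP) :
    (K : ℂ) * z * (z * cauchyTransform μ z - 1) =
      (((K : ℝ) * ∫ x, x / (1 + x^2) ∂μ : ℝ) : ℂ) + phiT (dens μ K) z := by
  have hz' : z.im ≠ 0 := ne_of_gt hz
  have hpos : ∀ x : ℝ, (1 + (x:ℂ)^2) ≠ 0 := by
    intro x
    have : (1 + x^2 : ℝ) ≠ 0 := by positivity
    exact_mod_cast this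
  have i1 : Integrable (fun x : ℝ => x / (1 + x^2)) μ := by
    apply Integrable.of_bound (C := 1)
    · apply Continuous.aestronglyMeasurable
      apply Continuous.div (by fun_prop) (by fun_prop)
      intro x; positivity
    · refine Eventually.of_forall fun x => ?_
      rw [Real.norm_eq_abs, abs_div, abs_of_pos (show 0 < 1 + x^2 by positivity), div_le_one (by positivity)]
      rw [abs_le]
      constructor <;> nlinarith [sq_nonneg (x-1), sq_nonneg (x+1)]
  have i2 : Integrable (fun x : ℝ => (((K : ℝ) * (x / (1 + x^2)) : ℝ) : ℂ)) μ := (i1.const_mul _).ofReal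
  have i3 : Integrable (fun x : ℝ => (K : ℂ) * z * (z * (z - (x:ℂ))⁻¹ - 1)) μ :=
    (((integrable_res hz' μ).const_mul z).sub (integrable_const _)).const_mul _
  have hptw : ∀ x : ℝ, (((K : ℝ) * x^2 / (1 + x^2) : ℝ) : ℂ) * ((1 + (x : ℂ) * z) / (z - (x : ℂ))) =
      (K : ℂ) * z * (z * (z - (x:ℂ))⁻¹ - 1) - (((K : ℝ) * (x / (1 + x^2)) : ℝ) : ℂ) := by
    intro x
    have h1 := sub_ofReal_ne hz' x
    have h2 := hpos x
    push_cast
    field_simp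
    ring
  rw [← phi_eq hz', dens_integral]
  simp only [hptw]
  rw [integral_sub i3 i2, integral_const_mul, integral_sub ((integrable_res hz' μ).const_mul z)
    (integrable_const _), integral_const_mul]
  rw [integral_complex_ofReal, integral_const_mul]
  simp [cauchyTransform]

lemma conv_a {K : ℕ → ℕ} (hK : Tendsto K atTop atTop) {G : ℕ → ℂ} (hG : ∀ n, G n ≠ 0) {z L : ℂ}
    (hz : z ≠ 0)
    (h : Tendsto (fun n => (K n : ℂ) * z * (z * G n - 1)) atTop (𝓝 L)) :
    Tendsto (fun n => (K n : ℂ) * ((G n)⁻¹ - z)) atTop (𝓝 (-L)) := by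
  have hinv : Tendsto (fun n => ((K n : ℂ))⁻¹) atTop (𝓝 0) :=
    (tendsto_inv_atTop_nhds_zero_nat (𝕜 := ℂ)).comp hK
  have h1 : Tendsto (fun n => z * G n) atTop (𝓝 1) := by
    have := ((h.mul hinv).mul_const z⁻¹).const_add 1
    simp only [mul_zero, zero_mul, add_zero] at this
    refine this.congr' ?_
    filter_upwards [hK.eventually_gt_atTop 0] with n hn
    have : (K n : ℂ) ≠ 0 := by exact_mod_cast hn.ne'
    field_simp
    ring
  have h2 := (h.div h1 one_ne_zero).neg
  rw [div_one] at h2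
  refine h2.congr (fun n => ?_)
  have := hG n
  simp only [Pi.div_apply]
  field_simp
  ring

lemma conv_b {K : ℕ → ℕ} (hK : Tendsto K atTop atTop) {G : ℕ → ℂ} (hG : ∀ n, G n ≠ 0) {z L : ℂ}
    (hz : z ≠ 0)
    (h : Tendsto (fun n => (K n : ℂ) * ((G n)⁻¹ - z)) atTop (𝓝 (-L))) :
    Tendsto (fun n => (K n : ℂ) * z * (z * G n - 1)) atTop (𝓝 L) := by
  have hinv : Tendsto (fun n => ((K n : ℂ))⁻¹) atTop (𝓝 0) :=
    (tendsto_inv_atTop_nhds_zero_nat (𝕜 := ℂ)).comp hK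
  have h1 : Tendsto (fun n => (G n)⁻¹) atTop (𝓝 z) := by
    have := (h.mul hinv).add_const z
    simp only [mul_zero, zero_add] at this
    refine this.congr' ?_
    filter_upwards [hK.eventually_gt_atTop 0] with n hn
    have : (K n : ℂ) ≠ 0 := by exact_mod_cast hn.ne'
    field_simp
    ring
  have h2 := (h.mul_const z).div h1 hz
  have h3 := h2.neg
  have h4 : -(-L * z / z) = L := by field_simp
  rw [h4] at h3
  refine h3.congr (fun n => ?_)
  have := hG n
  simp only [Pi.div_apply]
  field_simp
  ring

lemma bootstrap {A : ℂ → ℂ} (hAd : DifferentiableOn ℂ A UHP)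
    (hA : ∀ z ∈ UHP, z.im ≤ (A z).im) (k : ℕ)
    (hg : Tendsto (fun y : ℝ => ‖A (y * Complex.I) - y * Complex.I‖ / y) atTop (𝓝 0))
    {Y η : ℝ} (hY : 0 < Y) (hη : η ≤ 1 / 16)
    (hb : ∀ y, Y ≤ y → ‖A^[k] (y * Complex.I) - y * Complex.I‖ ≤ η * y) {y : ℝ} (hy : Y ≤ y) :
    ‖(k : ℂ) * (A (y * Complex.I) - y * Complex.I)‖ ≤ 2 * η * y := by
  set κ : ℝ → ℝ := fun y => k * ‖A (y * Complex.I) - y * Complex.I‖ / y with hκ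
  have hexp : Real.exp (1/4) - 1 ≤ 1/2 := by
    have := Real.exp_bound_div_one_sub_of_interval (x := 1/4) (by norm_num) (by norm_num)
    norm_num at this ⊢
    linarith
  have claim : ∀ y, Y ≤ y → κ y ≤ 1/4 →
      k * ‖A (y * Complex.I) - y * Complex.I‖ ≤ 2 * η * y := by
    intro y hy hle
    have hy0 : 0 < y := hY.trans_le hy
    have hU : ((y : ℂ) * Complex.I) ∈ UHP := by change 0 < ((y : ℂ) * Complex.I).im; rw [iy_im]; exact hy0
    have h1 := disc_est hAd hA hU k
    have h2 := hb y hy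
    rw [iy_im] at h1
    set w : ℂ := y * Complex.I
    have h3 : Real.exp (k * ‖A w - w‖ / y) - 1 ≤ 1/2 := by
      have := Real.exp_le_exp.2 hle
      linarith
    have h4 : 0 ≤ (A w - w).im := by simp only [Complex.sub_im]; linarith [hA w hU]
    have h5 : (A w - w).im ≤ ‖A w - w‖ := (le_abs_self _).trans (Complex.abs_im_le_norm _)
    have h6 : (Real.exp (k * ‖A w - w‖ / y) - 1) * (k * (A w - w).im) ≤ 1/2 * (k * ‖A w - w‖) := by
      have hk0 : (0:ℝ) ≤ k := by positivity
      have a1 : (Real.exp (k * ‖A w - w‖ / y) - 1) * (k * (A w - w).im) ≤ 1/2 * (k * (A w - w).im) := by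
        apply mul_le_mul_of_nonneg_right h3 (by positivity)
      have a2 : (k:ℝ) * (A w - w).im ≤ k * ‖A w - w‖ := by gcongr
      linarith
    have h7 : (k:ℝ) * ‖A w - w‖ ≤ ‖A^[k] w - w‖ + ‖A^[k] w - w - k * (A w - w)‖ := by
      have e : (k:ℂ) * (A w - w) = (A^[k] w - w) - (A^[k] w - w - k * (A w - w)) := by ring
      have : (k:ℝ) * ‖A w - w‖ = ‖(k:ℂ) * (A w - w)‖ := by simp
      rw [this]
      conv_lhs => rw [e]
      exact norm_sub_le _ _
    linarith
  have hall : ∀ y, Y ≤ y → κ y ≤ 1/4 := by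
    intro y1 hy1
    by_contra! hgt
    have hlim : Tendsto κ atTop (𝓝 0) := by
      have := hg.const_mul (k : ℝ)
      rw [mul_zero] at this
      refine this.congr (fun y => ?_)
      simp only [hκ]; ring
    obtain ⟨y3, h3a, h3b⟩ := ((hlim.eventually_lt_const (show (0:ℝ) < 1/4 by norm_num)).and
      (eventually_ge_atTop y1)).exists
    have hcont : ContinuousOn κ (Icc y1 y3) := by
      have hU : MapsTo (fun y : ℝ => (y : ℂ) * Complex.I) (Icc y1 y3) UHP := by
        intro y hy
        change 0 < ((y : ℂ) * Complex.I).im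
        rw [iy_im]; exact hY.trans_le (hy1.trans hy.1)
      have hc1 : ContinuousOn (fun y : ℝ => (y : ℂ) * Complex.I) (Icc y1 y3) := by fun_prop
      have hc2 := hAd.continuousOn.comp hc1 hU
      refine ContinuousOn.div (continuousOn_const.mul (hc2.sub hc1).norm) continuousOn_id ?_
      intro y hy
      exact (hY.trans_le (hy1.trans hy.1)).ne'
    obtain ⟨y2, hy2, he⟩ := intermediate_value_Icc' h3b hcont ⟨h3a.le, hgt.le⟩
    have hy2Y : Y ≤ y2 := hy1.trans hy2.1
    have hy20 : 0 < y2 := hY.trans_le hy2Y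
    have := claim y2 hy2Y he.le
    have h8 : κ y2 ≤ 2 * η := by
      simp only [hκ]; rw [div_le_iff₀ hy20]; exact this
    linarith
  have := claim y hy (hall y hy)
  simpa using this

/-- The generator `-(γ + phiT σ z)`. -/
noncomputable def genP (γ : ℝ) (σ : Measure ℝ) (z : ℂ) : ℂ := -((γ : ℂ) + phiT σ z)

lemma genP_diff (γ : ℝ) (σ : Measure ℝ) [IsFiniteMeasure σ] : DifferentiableOn ℂ (genP γ σ) UHP := by
  have := phi_diff σ
  unfold genP
  fun_prop

lemma genP_im (γ : ℝ) (σ : Measure ℝ) [IsFiniteMeasure σ] {z : ℂ} (hz : z ∈ UHP) :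
    0 ≤ (genP γ σ z).im := by
  have := phi_im hz σ
  simp only [genP, Complex.neg_im, Complex.add_im, Complex.ofReal_im]
  linarith

lemma genP_growth (γ : ℝ) (σ : Measure ℝ) [IsFiniteMeasure σ] :
    Tendsto (fun y : ℝ => ‖genP γ σ (y * Complex.I)‖ / y) atTop (𝓝 0) := by
  have h1 := ((tendsto_inv_atTop_zero (𝕜 := ℝ)).const_mul |γ|).add (phi_growth σ)
  simp only [mul_zero, zero_add] at h1
  refine squeeze_zero' ?_ ?_ h1
  · filter_upwards [eventually_gt_atTop 0] with y hy using by positivity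
  · filter_upwards [eventually_gt_atTop 0] with y hy
    have : ‖genP γ σ (y * Complex.I)‖ ≤ |γ| + ‖phiT σ (y * Complex.I)‖ := by
      rw [genP, norm_neg]
      refine (norm_add_le _ _).trans ?_
      simp
    calc _ ≤ (|γ| + ‖phiT σ (y * Complex.I)‖) / y := by gcongr
      _ = _ := by ring

lemma isGen_flow {γ : ℝ} {σ : Measure ℝ} [IsFiniteMeasure σ] {F : ℝ → ℂ → ℂ}
    (hF0 : ∀ z ∈ UHP, F 0 z = z)
    (hFm : ∀ t : ℝ, 0 ≤ t → ∀ z ∈ UHP, 0 < (F t z).im)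
    (hFder : ∀ z ∈ UHP, ∀ t : ℝ, 0 ≤ t →
      HasDerivWithinAt (fun s => F s z) (genP γ σ (F t z)) (Ici 0) t) :
    IsGen (F 1) (genP γ σ) := by
  have hAd : ∀ m : ℕ, DifferentiableOn ℂ (fun w => w + ((m : ℂ) + 1)⁻¹ * genP γ σ w) UHP := by
    intro m
    have := genP_diff γ σ
    fun_prop
  have hA : ∀ m : ℕ, ∀ z ∈ UHP, z.im ≤ ((fun w => w + ((m : ℂ) + 1)⁻¹ * genP γ σ w) z).im := by
    intro m z hz
    have h := genP_im γ σ hz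
    have e : (((m : ℂ) + 1)⁻¹) = (((m : ℝ) + 1)⁻¹ : ℝ) := by push_cast; rfl
    simp only [Complex.add_im]
    rw [e, Complex.im_ofReal_mul]
    have : 0 ≤ ((m : ℝ) + 1)⁻¹ * (genP γ σ z).im := by positivity
    linarith
  have hk : Tendsto (fun m : ℕ => m + 1) atTop atTop := tendsto_add_atTop_nat 1
  have hΨ : ∀ z ∈ UHP, Tendsto (fun m : ℕ => ((m + 1 : ℕ) : ℂ) *
      ((fun w => w + ((m : ℂ) + 1)⁻¹ * genP γ σ w) z - z)) atTop (𝓝 (genP γ σ z)) := by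
    intro z _
    refine tendsto_const_nhds.congr (fun m => ?_)
    have : (m : ℂ) + 1 ≠ 0 := by exact_mod_cast m.succ_ne_zero
    push_cast
    field_simp
    ring
  exact isGen_of_tendsto hAd hA hk (fun z hz => chernoff hAd hA hk hΨ hF0 hFm hFder hz) hΨ

lemma uniform_growth {μ : ℕ → Measure ℝ} [∀ n, IsProbabilityMeasure (μ n)] {k : ℕ → ℕ}
    {ρ : ℕ → Measure ℝ} [∀ n, IsProbabilityMeasure (ρ n)]
    (hρ : ∀ n, ∀ z : ℂ, 0 < z.im → Ftransform (ρ n) z = (Ftransform (μ n))^[k n] z)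
    {ν : Measure ℝ} [IsProbabilityMeasure ν] (h : WeakLim ρ ν) {ε : ℝ} (hε : 0 < ε) :
    ∃ Y : ℝ, 0 < Y ∧ ∀ᶠ n in atTop, ∀ y, Y ≤ y →
      ‖(k n : ℂ) * (Ftransform (μ n) (y * Complex.I) - y * Complex.I)‖ ≤ ε * y := by
  set e := min (ε / 4) (1 / 32) with he
  have he0 : 0 < e := by positivity
  have he1 : e ≤ ε / 4 := min_le_left _ _
  have he2 : e ≤ 1 / 32 := min_le_right _ _
  obtain ⟨Y, h1, hY⟩ := (((tail_tendsto ν).eventually_lt_const he0).and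
    (eventually_gt_atTop 0)).exists
  refine ⟨Y, hY, ?_⟩
  filter_upwards [(tail_weak h hY).eventually_lt_const h1] with n hn y hy
  have hy0 : 0 < y := hY.trans_le hy
  have hb : ∀ y, Y ≤ y → ‖(Ftransform (μ n))^[k n] (y * Complex.I) - y * Complex.I‖ ≤ (2 * e) * y := by
    intro y hy
    have hy0 : 0 < y := hY.trans_le hy
    rw [← hρ n _ (by rw [iy_im]; exact hy0)]
    exact F_tail hy0 (ρ n) (by linarith) ((tail_anti hY hy (ρ n)).trans hn.le)
  have := bootstrap (diff_F (μ n)) (fun z hz => F_im hz (μ n)) (k n) (F_growth (μ n)) hY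
    (η := 2 * e) (by linarith) hb hy
  refine this.trans ?_
  gcongr
  linarith

lemma gen_conv {μ : ℕ → Measure ℝ} [∀ n, IsProbabilityMeasure (μ n)] {k : ℕ → ℕ}
    (hk : Tendsto k atTop atTop)
    {ρ : ℕ → Measure ℝ} [∀ n, IsProbabilityMeasure (ρ n)]
    (hρ : ∀ n, ∀ z : ℂ, 0 < z.im → Ftransform (ρ n) z = (Ftransform (μ n))^[k n] z)
    {ν : Measure ℝ} [IsProbabilityMeasure ν] (h : WeakLim ρ ν) {Ψ : ℂ → ℂ}
    (hgen : IsGen (Ftransform ν) Ψ)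
    (hgr : Tendsto (fun y : ℝ => ‖Ψ (y * Complex.I)‖ / y) atTop (𝓝 0)) {z : ℂ} (hz : z ∈ UHP) :
    Tendsto (fun n => (k n : ℂ) * (Ftransform (μ n) z - z)) atTop (𝓝 (Ψ z)) := by
  set g : ℕ → ℂ → ℂ := fun n z => (k n : ℂ) * (Ftransform (μ n) z - z) with hg
  have hgd : ∀ n, DifferentiableOn ℂ (g n) UHP := fun n =>
    ((diff_F (μ n)).sub differentiableOn_id).const_mul _
  have hgm : ∀ n, ∀ z ∈ UHP, 0 ≤ (g n z).im := by
    intro n z hz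
    have e : (g n z).im = k n * (Ftransform (μ n) z - z).im := by simp [hg]
    rw [e, Complex.sub_im]
    have := F_im hz (μ n)
    have h2 : 0 ≤ (Ftransform (μ n) z).im - z.im := by linarith
    positivity
  have hρl : ∀ w ∈ UHP, Tendsto (fun n => (Ftransform (μ n))^[k n] w) atTop (𝓝 (Ftransform ν w)) := by
    intro w hw
    have := (tendsto_cauchy h (ne_of_gt (show 0 < w.im from hw))).inv₀ (cauchy_ne hw ν)
    exact this.congr (fun n => hρ n w hw)
  -- pointwise boundedness
  have hbd : ∀ w ∈ UHP, ∃ C : ℝ, ∀ᶠ n in atTop, g n w ∈ Metric.closedBall (0:ℂ) C := by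
    intro w hw
    obtain ⟨Y, hY, hev⟩ := uniform_growth hρ h (ε := 1) one_pos
    have hU : 0 < ((Y : ℂ) * Complex.I).im := by rw [iy_im]; exact hY
    refine ⟨Y + Y * |Real.exp (hypd w (Y * Complex.I)) - 1|, ?_⟩
    filter_upwards [hev] with n hn
    have h1 : ‖g n (Y * Complex.I)‖ ≤ Y := (hn Y le_rfl).trans_eq (one_mul Y)
    have h2 := harnack (hgd n) (hgm n) hw hU
    have h3 : (g n (Y * Complex.I)).im ≤ Y :=
      ((le_abs_self _).trans (Complex.abs_im_le_norm _)).trans h1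
    have h4 := hgm n _ hU
    rw [mem_closedBall_zero_iff]
    have h5 : ‖g n w‖ ≤ ‖g n (Y * Complex.I)‖ + ‖g n w - g n (Y * Complex.I)‖ := by
      have := norm_add_le (g n (Y * Complex.I)) (g n w - g n (Y * Complex.I))
      simpa using this
    have h6 : (g n (Y * Complex.I)).im * (Real.exp (hypd w (Y * Complex.I)) - 1) ≤
        Y * |Real.exp (hypd w (Y * Complex.I)) - 1| := by
      calc _ ≤ (g n (Y * Complex.I)).im * |Real.exp (hypd w (Y * Complex.I)) - 1| :=
            mul_le_mul_of_nonneg_left (le_abs_self _) h4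
        _ ≤ _ := mul_le_mul_of_nonneg_right h3 (abs_nonneg _)
    linarith
  rw [tendsto_iff_ultrafilter]
  intro U hU
  have hlim : ∀ w : ℂ, ∃ L : ℂ, w ∈ UHP → Tendsto (fun n => g n w) U (𝓝 L) := by
    intro w
    by_cases hw : w ∈ UHP
    · obtain ⟨C, hC⟩ := hbd w hw
      have hC' : ∀ᶠ n in (U : Filter ℕ), g n w ∈ Metric.closedBall (0:ℂ) C := hU hC
      obtain ⟨L, _, hL⟩ := (isCompact_closedBall (0:ℂ) C).ultrafilter_le_nhds
        (U.map (fun n => g n w)) (by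
          rw [le_principal_iff]
          exact hC')
      exact ⟨L, fun _ => hL⟩
    · exact ⟨0, fun hw' => absurd hw' hw⟩
  choose Ψ' hΨ' using hlim
  have hgen' : IsGen (Ftransform ν) Ψ' :=
    isGen_of_tendsto (l := (U : Filter ℕ)) (A := fun n => Ftransform (μ n)) (k := k)
      (fun n => diff_F (μ n)) (fun n z hz => F_im hz (μ n)) (hk.mono_left hU)
      (fun w hw => (hρl w hw).mono_left hU) hΨ'
  have hgr' : Tendsto (fun y : ℝ => ‖Ψ' (y * Complex.I)‖ / y) atTop (𝓝 0) := by
    rw [Metric.tendsto_atTop]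
    intro ε hε
    obtain ⟨Y, hY, hev⟩ := uniform_growth hρ h (ε := ε / 2) (by positivity)
    refine ⟨Y, fun y hy => ?_⟩
    have hy0 : 0 < y := hY.trans_le hy
    have h1 : ‖Ψ' (y * Complex.I)‖ ≤ ε / 2 * y := by
      refine le_of_tendsto (hΨ' (y * Complex.I) (by
        change 0 < ((y : ℂ) * Complex.I).im; rw [iy_im]; exact hy0)).norm ?_
      have hev' := hU hev
      filter_upwards [hev'] with n hn using hn y hy
    rw [Real.dist_eq, sub_zero, abs_of_nonneg (by positivity), div_lt_iff₀ hy0]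
    nlinarith
  have := uniq_gen (diff_F ν) (fun z hz => F_im hz ν) (F_growth ν) hgen' hgen hgr' hgr hz
  rw [← this]
  exact hΨ' z hz

lemma dens_conv {μ : ℕ → Measure ℝ} [∀ n, IsProbabilityMeasure (μ n)] {k : ℕ → ℕ}
    {σ : Measure ℝ} [IsFiniteMeasure σ] {γ : ℝ}
    (h : ∀ z ∈ UHP, Tendsto (fun n => (((k n : ℝ) * ∫ x, x / (1 + x^2) ∂(μ n) : ℝ) : ℂ) +
      phiT (dens (μ n) (k n)) z) atTop (𝓝 ((γ : ℂ) + phiT σ z))) :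
    WeakLim (fun n => dens (μ n) (k n)) σ ∧
      Tendsto (fun n => (k n : ℝ) * ∫ x, x / (1 + x^2) ∂(μ n)) atTop (𝓝 γ) := by
  have hI : Complex.I ∈ UHP := by change 0 < Complex.I.im; simp
  have h0 := h Complex.I hI
  simp only [phi_I] at h0
  have hγ : Tendsto (fun n => (k n : ℝ) * ∫ x, x / (1 + x^2) ∂(μ n)) atTop (𝓝 γ) := by
    have := (Complex.continuous_re.tendsto _).comp h0
    simp only [Function.comp_def, Complex.add_re, Complex.ofReal_re, Complex.mul_re, Complex.neg_re,
      Complex.I_re, Complex.neg_im, Complex.I_im, Complex.ofReal_im, mul_zero, neg_zero, zero_mul,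
      sub_zero, add_zero] at this
    exact this
  have hm : Tendsto (fun n => (dens (μ n) (k n)).real univ) atTop (𝓝 (σ.real univ)) := by
    have := ((Complex.continuous_im.tendsto _).comp h0).neg
    simp only [Function.comp_def, Complex.add_im, Complex.ofReal_re, Complex.mul_im, Complex.neg_re,
      Complex.I_re, Complex.neg_im, Complex.I_im, Complex.ofReal_im, mul_zero, neg_zero, zero_mul,
      zero_add, neg_mul, one_mul, neg_neg] at this
    exact this
  refine ⟨weakLim_of_cauchy hm ?_, hγ⟩
  intro z hz hzI
  have hne : 1 + z^2 ≠ 0 := by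
    intro h0
    have e : (z - Complex.I) * (z + Complex.I) = 0 := by
      ring_nf; rw [Complex.I_sq, ← h0]; ring
    rcases mul_eq_zero.1 e with e | e
    · exact hzI (sub_eq_zero.1 e)
    · have := congrArg Complex.im e
      simp at this
      linarith
  have hγc : Tendsto (fun n => (((k n : ℝ) * ∫ x, x / (1 + x^2) ∂(μ n) : ℝ) : ℂ)) atTop (𝓝 (γ : ℂ)) :=
    (Complex.continuous_ofReal.tendsto _).comp hγ
  have hmc : Tendsto (fun n => ((dens (μ n) (k n)).real univ : ℂ)) atTop (𝓝 (σ.real univ : ℂ)) :=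
    (Complex.continuous_ofReal.tendsto _).comp hm
  have h1 := (((h z hz).sub hγc).add (hmc.const_mul z)).const_mul (1 + z^2)⁻¹
  have key : ∀ (c : ℂ) (τ : Measure ℝ),
      (1 + z^2)⁻¹ * (c + phiT τ z - c + z * (τ.real univ : ℂ)) = cauchyTransform τ z := by
    intro c τ
    unfold phiT
    field_simp
    ring
  rw [key] at h1
  exact h1.congr (fun n => key _ _)

/-- (Monotone part of the Bercovici–Pata limit theorem.) The monotone convolution
powers `ρ_n = μ_n^{▷ k_n}`, characterized by `F_{ρ_n} = F_{μ_n}^{∘ k_n}` on `ℂ⁺`,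
converge weakly to the monotone infinitely divisible measure `ν = ν_▷^{γ,σ}`,
characterized by `F_ν = F_1` for the flow `∂_t F_t = -Φ(F_t)`, `F_0 = id`, with
generator `Φ(z) = γ + ∫ (1+xz)/(z-x) dσ(x)`, iff `k_n x²/(1+x²) dμ_n → σ` weakly
and `k_n ∫ x/(1+x²) dμ_n → γ`. -/
theorem bercovici_pata_monotone
    (σ : Measure ℝ) [IsFiniteMeasure σ] (γ : ℝ)
    (μ : ℕ → Measure ℝ) [∀ n, IsProbabilityMeasure (μ n)]
    (k : ℕ → ℕ) (hkmono : StrictMono k) (hkpos : ∀ n, 0 < k n)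
    (ρ : ℕ → Measure ℝ) [∀ n, IsProbabilityMeasure (ρ n)]
    (hρ : ∀ n, ∀ z : ℂ, 0 < z.im →
      Ftransform (ρ n) z = (Ftransform (μ n))^[k n] z)
    (Φ : ℂ → ℂ)
    (hΦ : ∀ z : ℂ, 0 < z.im →
      Φ z = (γ : ℂ) + ∫ x, (1 + (x : ℂ) * z) / (z - (x : ℂ)) ∂σ)
    (F : ℝ → ℂ → ℂ)
    (hF0 : ∀ z : ℂ, 0 < z.im → F 0 z = z)
    (hFmaps : ∀ t : ℝ, 0 ≤ t → ∀ z : ℂ, 0 < z.im → 0 < (F t z).im)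
    (hFanal : ∀ t : ℝ, 0 ≤ t → AnalyticOnNhd ℂ (F t) {z : ℂ | 0 < z.im})
    (hFderiv : ∀ z : ℂ, 0 < z.im → ∀ t : ℝ, 0 ≤ t →
      HasDerivWithinAt (fun s => F s z) (-(Φ (F t z))) (Ici 0) t)
    (ν : Measure ℝ) [IsProbabilityMeasure ν]
    (hν : ∀ z : ℂ, 0 < z.im → Ftransform ν z = F 1 z) :
    WeakLim ρ ν ↔
      (WeakLim (fun n => (μ n).withDensity
            (fun x => ENNReal.ofReal ((k n : ℝ) * x^2 / (1 + x^2)))) σ ∧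
        Tendsto (fun n => (k n : ℝ) * ∫ x, x / (1 + x^2) ∂(μ n)) atTop (𝓝 γ)) := by
  have hkt : Tendsto k atTop atTop := hkmono.tendsto_atTop
  have hder : ∀ z ∈ UHP, ∀ t : ℝ, 0 ≤ t →
      HasDerivWithinAt (fun s => F s z) (genP γ σ (F t z)) (Ici 0) t := by
    intro z hz t ht
    have h := hFderiv z hz t ht
    have hU := hFmaps t ht z hz
    rw [hΦ _ hU, phi_eq hU.ne'] at h
    exact h
  have hne0 : ∀ z ∈ UHP, z ≠ 0 := by
    rintro z hz rfl
    exact lt_irrefl _ (show (0:ℝ) < (0:ℂ).im from hz)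
  change WeakLim ρ ν ↔ (WeakLim (fun n => dens (μ n) (k n)) σ ∧ _)
  constructor
  · intro h
    have hgen0 := isGen_flow (γ := γ) (σ := σ) hF0 hFmaps hder
    have hgen : IsGen (Ftransform ν) (genP γ σ) := by
      have hd : ∀ z ∈ UHP, deriv (Ftransform ν) z = deriv (F 1) z := by
        intro z hz
        apply Filter.EventuallyEq.deriv_eq
        filter_upwards [isOpen_UHP.mem_nhds hz] with w hw using hν w hw
      refine ⟨hgen0.diff, hgen0.im_nonneg, ?_, ?_, ?_, ?_⟩
      · intro z hz; rw [hd z hz, hν z hz]; exact hgen0.comm z hz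
      · intro z hz; rw [hν z hz]; exact hgen0.contr z hz
      · intro z hz; rw [hν z hz]; exact hgen0.est z hz
      · intro z hz; rw [hν z hz]; exact hgen0.est_im z hz
    apply dens_conv
    intro z hz
    have h1 := gen_conv hkt hρ h hgen (genP_growth γ σ) hz
    have h2 := conv_b hkt (fun n => cauchy_ne hz (μ n)) (hne0 z hz) h1
    exact h2.congr (fun n => key_identity (μ n) (k n) hz)
  · rintro ⟨h1, h2⟩
    have hcon : ∀ z ∈ UHP, Tendsto (fun n => (k n : ℂ) * (Ftransform (μ n) z - z)) atTop
        (𝓝 (genP γ σ z)) := by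
      intro z hz
      have hz' : z.im ≠ 0 := ne_of_gt (show 0 < z.im from hz)
      have a1 := tendsto_cauchy h1 hz'
      have a2 := (Complex.continuous_ofReal.tendsto _).comp (tendsto_mass h1)
      have a3 := (Complex.continuous_ofReal.tendsto _).comp h2
      have a4 := a3.add ((a1.const_mul (1 + z^2)).sub (a2.const_mul z))
      exact conv_a hkt (fun n => cauchy_ne hz (μ n)) (hne0 z hz)
        (a4.congr (fun n => (key_identity (μ n) (k n) hz).symm))
    apply weakLim_of_cauchy
    · simp
    · intro z hz _
      have b1 := chernoff (A := fun n => Ftransform (μ n)) (fun n => diff_F (μ n))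
        (fun n z hz => F_im hz (μ n)) hkt hcon hF0 hFmaps hder hz
      have b2 : Tendsto (fun n => Ftransform (ρ n) z) atTop (𝓝 (Ftransform ν z)) := by
        rw [hν z hz]
        exact b1.congr (fun n => (hρ n z hz).symm)
      have b3 := b2.inv₀ (inv_ne_zero (cauchy_ne hz ν))
      simpa [Ftransform] using b3
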